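/- Let k be a field, P = k[x_1, …, x_n], ω ∈ (ℤ_{>0})^n a weight vector, and I ⊆ P a graded ideal. Then c(P/in_ω(I)) ≥ depth(P/I) − 1, where depth is taken with respect to the maximal homogeneous ideal. In particular, if P/I is Cohen-Macaulay, then P/in_ω(I) is connected in codimension 1. -/

import Mathlib

set_option synthInstance.maxHeartbeats 1000000
set_option maxHeartbeats 1000000

/-!
Auxiliary definitions: integer-valued topological (Krull) dimension, connectivity
dimension, subdimension, local cohomological dimension and depth.
-/

open TopologicalSpace

/-- The (topological Krull) dimension of a topological space, as an integer:
the supremum of the lengths of strictly increasing chains of irreducible closed subsets,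
with the convention that the empty space has dimension `-1`. -/
noncomputable def topDim (T : Type*) [TopologicalSpace T] : ℤ :=
  sSup ({-1} ∪ {d : ℤ | ∃ n : ℕ, d = (n : ℤ) ∧
    ∃ c : Fin (n + 1) → IrreducibleCloseds T, StrictMono c})

/-- The connectivity dimension `c(T)` of a topological space `T`: the minimum of `topDim Z`
over the closed subsets `Z ⊆ T` such that `T \ Z` is disconnected, the empty space counting
as disconnected (of dimension `-1`). -/
noncomputable def connDim (T : Type*) [TopologicalSpace T] : ℤ :=
  sInf {d : ℤ | ∃ Z : Set T, IsClosed Z ∧ ¬ ConnectedSpace ↥(Zᶜ) ∧ d = topDim ↥Z}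

/-- The subdimension `sdim T` of a topological space: the minimum of the dimensions of its
irreducible components. -/
noncomputable def subDim (T : Type*) [TopologicalSpace T] : ℤ :=
  sInf {d : ℤ | ∃ C ∈ irreducibleComponents T, d = topDim ↥C}

/-- The connectivity dimension `c(R)` of a commutative ring `R`, i.e. that of `Spec R`. -/
noncomputable def ringConnDim (R : Type) [CommRing R] : ℤ :=
  connDim (PrimeSpectrum R)

/-- The cohomological dimension `cd(M, a) = sup { i ∈ ℕ | H^i_a(M) ≠ 0 }` of an ideal `a`
with respect to a module `M`, where `H^i_a` is local cohomology with support in `a`. -/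
noncomputable def cohDim (R : Type) [CommRing R] (a : Ideal R)
    (M : Type) [AddCommGroup M] [Module R M] : ℤ :=
  sSup {d : ℤ | ∃ i : ℕ, d = (i : ℤ) ∧
    Nontrivial ((localCohomology a i).obj (ModuleCat.of R M))}

/-- `depth(a, M)`: the supremum of the lengths of `M`-regular sequences contained in the
ideal `a`. -/
noncomputable def idealDepth (R : Type) [CommRing R] (a : Ideal R)
    (M : Type) [AddCommGroup M] [Module R M] : ℤ :=
  sSup {d : ℤ | ∃ rs : List R, d = (rs.length : ℤ) ∧ (∀ r ∈ rs, r ∈ a) ∧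
    RingTheory.Sequence.IsRegular M rs}

/-- The `ω`-degree of a polynomial: `deg_ω f = max { ω·a | x^a is a term of f }`. -/
noncomputable def wDeg {k : Type} [Field k] {n : ℕ} (ω : Fin n → ℕ)
    (f : MvPolynomial (Fin n) k) : ℕ :=
  f.support.sup fun a => ∑ i, ω i * a i

/-- The initial form `in_ω(f)`: the sum of the terms of `f` of maximal `ω`-degree. -/
noncomputable def initialForm {k : Type} [Field k] {n : ℕ} (ω : Fin n → ℕ)
    (f : MvPolynomial (Fin n) k) : MvPolynomial (Fin n) k :=
  ∑ a ∈ f.support.filter (fun a => ∑ i, ω i * a i = wDeg ω f),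
    MvPolynomial.monomial a (f.coeff a)

/-- The initial ideal `in_ω(I)` of an ideal `I`, generated by the initial forms of its
nonzero elements. -/
noncomputable def initialIdeal {k : Type} [Field k] {n : ℕ} (ω : Fin n → ℕ)
    (I : Ideal (MvPolynomial (Fin n) k)) : Ideal (MvPolynomial (Fin n) k) :=
  Ideal.span {g | ∃ f ∈ I, f ≠ 0 ∧ g = initialForm ω f}

/-- An ideal of a polynomial ring is graded if it contains all the (standard-)homogeneous
components of each of its elements. -/
def IsGradedIdeal {k : Type} [Field k] {n : ℕ} (I : Ideal (MvPolynomial (Fin n) k)) : Prop :=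
  ∀ f ∈ I, ∀ d : ℕ, MvPolynomial.homogeneousComponent d f ∈ I

set_option synthInstance.maxHeartbeats 1000000
set_option maxHeartbeats 1000000

section GenDepth
variable {A : Type} [CommRing A] (W : Submonoid A) (m : Ideal A)

def wCl (a : Ideal A) : Ideal A where
  carrier := {z | ∃ r ∈ W, r * z ∈ a}
  add_mem' := by
    rintro x y ⟨r, hr, hx⟩ ⟨s, hs, hy⟩
    refine ⟨r * s, W.mul_mem hr hs, ?_⟩
    have : r * s * (x + y) = s * (r * x) + r * (s * y) := by ring
    rw [this]
    exact a.add_mem (a.mul_mem_left _ hx) (a.mul_mem_left _ hy)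
  zero_mem' := ⟨1, W.one_mem, by simp⟩
  smul_mem' := by
    rintro c x ⟨r, hr, hx⟩
    refine ⟨r, hr, ?_⟩
    have : r * (c • x) = c * (r * x) := by simp only [smul_eq_mul]; ring
    rw [this]
    exact a.mul_mem_left _ hx

theorem mem_wCl {a : Ideal A} {z : A} : z ∈ wCl W a ↔ ∃ r ∈ W, r * z ∈ a := Iff.rfl

theorem le_wCl (a : Ideal A) : a ≤ wCl W a := fun z hz => ⟨1, W.one_mem, by simpa using hz⟩

theorem wCl_mono {a b : Ideal A} (h : a ≤ b) : wCl W a ≤ wCl W b :=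
  fun _ ⟨r, hr, hz⟩ => ⟨r, hr, h hz⟩

theorem wCl_of_mul {a : Ideal A} {r z : A} (hr : r ∈ W) (h : r * z ∈ wCl W a) : z ∈ wCl W a := by
  obtain ⟨s, hs, h⟩ := h
  exact ⟨s * r, W.mul_mem hs hr, by rwa [mul_assoc]⟩

theorem wCl_wCl (a : Ideal A) : wCl W (wCl W a) = wCl W a :=
  le_antisymm (fun _ ⟨_, hr, h⟩ => wCl_of_mul W hr h) (le_wCl W _)

theorem mem_wCl_sup {a : Ideal A} {x z : A} :
    z ∈ wCl W (a ⊔ Ideal.span {x}) ↔ ∃ r ∈ W, ∃ v, r * z - x * v ∈ wCl W a := by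
  constructor
  · rintro ⟨r, hr, h⟩
    obtain ⟨y, hy, w, hw, e⟩ := Submodule.mem_sup.1 h
    obtain ⟨v, rfl⟩ := Ideal.mem_span_singleton'.1 hw
    refine ⟨r, hr, v, le_wCl W a ?_⟩
    rw [← e]; convert hy using 1; ring
  · rintro ⟨r, hr, v, h⟩
    refine wCl_of_mul W hr ?_
    have : r * z = (r * z - x * v) + x * v := by ring
    rw [this]
    refine add_mem (wCl_mono W le_sup_left h) (le_wCl W _ ?_)
    exact Ideal.mem_sup_right (Ideal.mul_mem_right _ _ (Ideal.mem_span_singleton_self x))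

/-- `x` is a nonzerodivisor modulo the `W`-closure of `a`. -/
def wReg (a : Ideal A) (x : A) : Prop := ∀ z, x * z ∈ wCl W a → z ∈ wCl W a

/-- Existence of a `W`-regular sequence of length `d` in `m`. -/
def wDp : ℕ → Ideal A → Prop
  | 0, _ => True
  | d + 1, a => ∃ x ∈ m, wReg W a x ∧ wDp d (a ⊔ Ideal.span {x})

theorem wReg_congr {a b : Ideal A} (h : wCl W a = wCl W b) {x : A} (hx : wReg W a x) :
    wReg W b x := by
  unfold wReg at *; rwa [← h]

theorem wCl_sup_congr {a b : Ideal A} (h : wCl W a = wCl W b) (x : A) :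
    wCl W (a ⊔ Ideal.span {x}) = wCl W (b ⊔ Ideal.span {x}) := by
  ext z; rw [mem_wCl_sup, mem_wCl_sup, h]

theorem wDp_congr (d : ℕ) {a b : Ideal A} (h : wCl W a = wCl W b) (hd : wDp W m d a) :
    wDp W m d b := by
  induction d generalizing a b with
  | zero => trivial
  | succ d ih =>
    obtain ⟨x, hx, h1, h2⟩ := hd
    exact ⟨x, hx, wReg_congr W h h1, ih (wCl_sup_congr W h x) h2⟩

theorem wReg_perm {a : Ideal A} {x y : A} (hx : wReg W a x)
    (hy : wReg W (a ⊔ Ideal.span {x}) y) : wReg W (a ⊔ Ideal.span {y}) x := by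
  intro z hz
  obtain ⟨r, hr, v, h⟩ := (mem_wCl_sup W).1 hz
  have h1 : y * v ∈ wCl W (a ⊔ Ideal.span {x}) := by
    refine (mem_wCl_sup W).2 ⟨1, W.one_mem, r * z, ?_⟩
    have : 1 * (y * v) - x * (r * z) = - (r * (x * z) - y * v) := by ring
    rw [this]; exact neg_mem h
  obtain ⟨s, hs, u, h2⟩ := (mem_wCl_sup W).1 (hy _ h1)
  refine (mem_wCl_sup W).2 ⟨r * s, W.mul_mem hr hs, u, hx _ ?_⟩
  have : x * (r * s * z - y * u) = s * (r * (x * z) - y * v) + y * (s * v - x * u) := by ring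
  rw [this]
  exact add_mem (Ideal.mul_mem_left _ _ h) (Ideal.mul_mem_left _ _ h2)

theorem reg_of_notMem_ass [IsNoetherianRing A] {J : Ideal A} {y : A}
    (hy : ∀ p ∈ associatedPrimes A (A ⧸ J), y ∉ p) (z : A) (hz : y * z ∈ J) : z ∈ J := by
  by_contra hzJ
  have : y ∈ ⋃ p ∈ associatedPrimes A (A ⧸ J), (p : Set A) := by
    rw [biUnion_associatedPrimes_eq_zero_divisors]
    refine ⟨Ideal.Quotient.mk J z, by rwa [Ne, Ideal.Quotient.eq_zero_iff_mem], ?_⟩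
    rw [← Ideal.Quotient.mk_eq_mk, ← Submodule.Quotient.mk_smul]
    exact (Submodule.Quotient.mk_eq_zero _).2 hz
  simp only [Set.mem_iUnion] at this
  obtain ⟨p, hp, h⟩ := this
  exact hy p hp h

theorem ass_not_le [IsNoetherianRing A] {J : Ideal A}
    (h : ∀ w, (∀ y ∈ m, y * w ∈ J) → w ∈ J) :
    ∀ p ∈ associatedPrimes A (A ⧸ J), ¬ m ≤ p := by
  intro p hp hm
  obtain ⟨hpp, x, hx⟩ := isAssociatedPrime_iff.1 hp
  obtain ⟨w, rfl⟩ := Ideal.Quotient.mk_surjective x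
  have hw : w ∈ J := by
    refine h w fun y hy => ?_
    have := hm hy
    rw [hx] at this
    simp only [Submodule.mem_colon_singleton, Submodule.mem_bot] at this
    rw [← Ideal.Quotient.mk_eq_mk, ← Submodule.Quotient.mk_smul] at this
    exact (Submodule.Quotient.mk_eq_zero _).1 this
  apply hpp.ne_top
  rw [hx, Ideal.Quotient.eq_zero_iff_mem.2 hw]
  simp

theorem avoid_finite {S : Set (Ideal A)} (hS : S.Finite) (hp : ∀ p ∈ S, p.IsPrime)
    (hm : ∀ p ∈ S, ¬ m ≤ p) : ∃ y ∈ m, ∀ p ∈ S, y ∉ p := by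
  by_contra hcon
  push Not at hcon
  have : (m : Set A) ⊆ ⋃ p ∈ S, (p : Set A) := by
    intro y hy
    obtain ⟨p, hp, h⟩ := hcon y hy
    simp only [Set.mem_iUnion]
    exact ⟨p, hp, h⟩
  rw [Ideal.subset_union_prime_finite hS ⊤ ⊤ (fun i hi _ _ => hp i hi)] at this
  obtain ⟨p, hp, h⟩ := this
  exact hm p hp h

theorem wReg_of_notMem [IsNoetherianRing A] {a : Ideal A} {y : A}
    (hy : ∀ p ∈ associatedPrimes A (A ⧸ wCl W a), y ∉ p) : wReg W a y :=
  reg_of_notMem_ass hy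

theorem wAss_not_le [IsNoetherianRing A] {a : Ideal A} {x : A} (hx : x ∈ m) (h : wReg W a x) :
    ∀ p ∈ associatedPrimes A (A ⧸ wCl W a), ¬ m ≤ p :=
  ass_not_le m fun w hw => h w (hw x hx)

theorem wDp_exchange [IsNoetherianRing A] (d : ℕ) (a : Ideal A) (f : A)
    (hd : wDp W m (d + 1) a) (hf : wReg W a f) : wDp W m d (a ⊔ Ideal.span {f}) := by
  induction d generalizing a f with
  | zero => trivial
  | succ d ih =>
    obtain ⟨x, hxm, hx, y0, hy0m, hy0, hd⟩ := hd
    have h3 : ∀ p ∈ associatedPrimes A (A ⧸ wCl W (a ⊔ Ideal.span {f})), ¬ m ≤ p := by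
      refine ass_not_le m fun w hw => ?_
      obtain ⟨r, hr, v, hv⟩ := (mem_wCl_sup W).1 (hw x hxm)
      have hvx : v ∈ wCl W (a ⊔ Ideal.span {x}) := by
        apply hy0
        obtain ⟨s, hs, u, hu⟩ := (mem_wCl_sup W).1 (hw y0 hy0m)
        refine (mem_wCl_sup W).2 ⟨s, hs, r * u, hf _ ?_⟩
        have : f * (s * (y0 * v) - x * (r * u)) =
          (r * x) * (s * (y0 * w) - f * u) - (s * y0) * (r * (x * w) - f * v) := by ring
        rw [this]
        exact sub_mem (Ideal.mul_mem_left _ _ hu) (Ideal.mul_mem_left _ _ hv)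
      obtain ⟨s, hs, u, hu⟩ := (mem_wCl_sup W).1 hvx
      refine (mem_wCl_sup W).2 ⟨r * s, W.mul_mem hr hs, u, hx _ ?_⟩
      have : x * (r * s * w - f * u) = s * (r * (x * w) - f * v) + f * (s * v - x * u) := by ring
      rw [this]
      exact add_mem (Ideal.mul_mem_left _ _ hv) (Ideal.mul_mem_left _ _ hu)
    obtain ⟨y, hym, hy⟩ := avoid_finite m
      (S := associatedPrimes A (A ⧸ wCl W a) ∪
        (associatedPrimes A (A ⧸ wCl W (a ⊔ Ideal.span {x})) ∪
        associatedPrimes A (A ⧸ wCl W (a ⊔ Ideal.span {f}))))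
      ((associatedPrimes.finite A _).union ((associatedPrimes.finite A _).union
        (associatedPrimes.finite A _)))
      (by rintro p (hp | hp | hp) <;> exact hp.isPrime)
      (by
        rintro p (hp | hp | hp)
        · exact wAss_not_le W m hxm hx p hp
        · exact wAss_not_le W m hy0m hy0 p hp
        · exact h3 p hp)
    have hy1 : wReg W a y := wReg_of_notMem W fun p hp => hy p (Or.inl hp)
    have hy2 : wReg W (a ⊔ Ideal.span {x}) y :=
      wReg_of_notMem W fun p hp => hy p (Or.inr (Or.inl hp))
    have hy3 : wReg W (a ⊔ Ideal.span {f}) y :=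
      wReg_of_notMem W fun p hp => hy p (Or.inr (Or.inr hp))
    have e1 := ih (a ⊔ Ideal.span {x}) y ⟨y0, hy0m, hy0, hd⟩ hy2
    rw [sup_right_comm] at e1
    have e2 : wDp W m (d + 1) (a ⊔ Ideal.span {y}) := ⟨x, hxm, wReg_perm W hx hy2, e1⟩
    have e3 := ih _ f e2 (wReg_perm W hf hy3)
    rw [sup_right_comm] at e3
    exact ⟨y, hym, hy3, e3⟩

end GenDepth

set_option synthInstance.maxHeartbeats 1000000
set_option maxHeartbeats 1000000

section Graded
open DirectSum Polynomial

variable {k : Type} [Field k] {A : Type} [CommRing A] [Algebra k[X] A]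
  (𝒜 : ℕ → Submodule k[X] A) [GradedAlgebra 𝒜] (m : Ideal A)

structure StdGr : Prop where
  h1 : ∀ d, ∀ z ∈ 𝒜 d, z ∈ m ^ d
  h2 : ∀ j, ∀ z ∈ m ^ j, ∀ i < j, (decompose 𝒜 z i : A) = 0
  h0 : ∀ z ∈ 𝒜 0, ∃ r : k[X], algebraMap k[X] A r = z
  inj : Function.Injective (algebraMap k[X] A)

theorem hom_split {J : Ideal A} (hJ : J.IsHomogeneous 𝒜) {f z : A} {e d D : ℕ} (hf : f ∈ 𝒜 e)
    (hz : z ∈ 𝒜 D) (hD : D = e + d) (h : z ∈ J ⊔ Ideal.span {f}) :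
    ∃ v ∈ 𝒜 d, z - f * v ∈ J := by
  subst hD
  obtain ⟨y, hy, w, hw, ee⟩ := Submodule.mem_sup.1 h
  obtain ⟨v, rfl⟩ := Ideal.mem_span_singleton'.1 hw
  refine ⟨decompose 𝒜 v d, SetLike.coe_mem _, ?_⟩
  have h1 : z - f * v = y := by rw [← ee]; ring
  have h2 := hJ (e + d) hy
  rw [← h1, decompose_sub, DirectSum.sub_apply, Submodule.coe_sub, decompose_of_mem_same 𝒜 hz,
    coe_decompose_mul_add_of_left_mem 𝒜 hf] at h2
  exact h2

theorem hom_split2 {J K : Ideal A} (hJ : J.IsHomogeneous 𝒜) (hK : K.IsHomogeneous 𝒜) {z : A}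
    {D : ℕ} (hz : z ∈ 𝒜 D) (h : z ∈ J ⊔ K) :
    ∃ b ∈ J, ∃ c ∈ K, b ∈ 𝒜 D ∧ c ∈ 𝒜 D ∧ z = b + c := by
  obtain ⟨y, hy, w, hw, ee⟩ := Submodule.mem_sup.1 h
  refine ⟨_, hJ D hy, _, hK D hw, SetLike.coe_mem _, SetLike.coe_mem _, ?_⟩
  rw [← Submodule.coe_add, ← DirectSum.add_apply, ← decompose_add, ee, decompose_of_mem_same 𝒜 hz]

theorem hom_span {f : A} {e : ℕ} (hf : f ∈ 𝒜 e) : (Ideal.span {f}).IsHomogeneous 𝒜 :=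
  Ideal.homogeneous_span 𝒜 _ (by rintro x rfl; exact ⟨e, hf⟩)

theorem hom_sup_span {J : Ideal A} (hJ : J.IsHomogeneous 𝒜) {f : A} {e : ℕ} (hf : f ∈ 𝒜 e) :
    (J ⊔ Ideal.span {f}).IsHomogeneous 𝒜 := hJ.sup (hom_span 𝒜 hf)

theorem hom_pow {J : Ideal A} (hJ : J.IsHomogeneous 𝒜) (N : ℕ) : (J ^ N).IsHomogeneous 𝒜 := by
  induction N with
  | zero => rw [pow_zero, Ideal.one_eq_top]; exact Ideal.IsHomogeneous.top 𝒜
  | succ N ih => rw [pow_succ]; exact ih.mul hJ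

/-- all high degree elements multiply z into J -/
def Kills (M : ℕ) (z : A) (J : Ideal A) : Prop := ∀ e, M ≤ e → ∀ u ∈ 𝒜 e, u * z ∈ J

variable {𝒜 m}

theorem StdGr.kills_pow (H : StdGr 𝒜 m) {M : ℕ} {z : A} {J : Ideal A} (h : Kills 𝒜 M z J) :
    ∀ u ∈ m ^ M, u * z ∈ J := by
  intro u hu
  classical
  rw [← sum_support_decompose 𝒜 u, Finset.sum_mul]
  refine J.sum_mem fun i _ => ?_
  by_cases hi : i < M
  · rw [H.h2 M u hu i hi]; simp
  · exact h i (not_lt.1 hi) _ (SetLike.coe_mem _)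

theorem StdGr.mem_pow (H : StdGr 𝒜 m) {d j : ℕ} {z : A} (hz : z ∈ 𝒜 d) (h : j ≤ d) : z ∈ m ^ j :=
  Ideal.pow_le_pow_right h (H.h1 d z hz)

theorem Kills.mono {M M' : ℕ} {z : A} {J J' : Ideal A} (h : Kills 𝒜 M z J) (hM : M ≤ M')
    (hJ : J ≤ J') : Kills 𝒜 M' z J' := fun e he u hu => hJ (h e (hM.trans he) u hu)

theorem StdGr.exists_hom_notMem (H : StdGr 𝒜 m) {p : Ideal A} (hp : ¬ m ≤ p) :
    ∃ a, 1 ≤ a ∧ ∃ w ∈ 𝒜 a, w ∉ p := by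
  obtain ⟨x, hx, hxp⟩ := SetLike.not_le_iff_exists.1 hp
  by_contra hcon
  push Not at hcon
  apply hxp
  classical
  rw [← sum_support_decompose 𝒜 x]
  refine p.sum_mem fun i _ => ?_
  by_cases hi : i < 1
  · rw [H.h2 1 x (by simpa using hx) i hi]; simp
  · exact hcon i (not_lt.1 hi) _ (SetLike.coe_mem _)

theorem StdGr.avoid_aux (H : StdGr 𝒜 m) (N : ℕ) : ∀ S : Finset (Ideal A), S.card ≤ N →
    (∀ p ∈ S, p.IsPrime) → (∀ p ∈ S, ¬ m ≤ p) →
    ∃ a, 1 ≤ a ∧ ∃ y ∈ 𝒜 a, ∀ p ∈ S, y ∉ p := by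
  classical
  induction N with
  | zero =>
    intro S hS _ _
    have : S = ∅ := Finset.card_eq_zero.1 (Nat.le_zero.1 hS)
    subst this
    exact ⟨1, le_rfl, 0, zero_mem _, by simp⟩
  | succ N ih =>
    intro S hS hp hm
    rcases S.eq_empty_or_nonempty with rfl | ⟨p, hpS⟩
    · exact ⟨1, le_rfl, 0, zero_mem _, by simp⟩
    by_cases hq : ∃ q ∈ S.erase p, ∀ b, ∀ z ∈ 𝒜 b, z ∈ q → z ∈ p
    · obtain ⟨q, hqS, hq⟩ := hq
      have hqS' := Finset.mem_of_mem_erase hqS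
      obtain ⟨a, ha, y, hy, hyS⟩ := ih (S.erase q)
        (by rw [Finset.card_erase_of_mem hqS']; omega)
        (fun r hr => hp r (Finset.mem_of_mem_erase hr))
        (fun r hr => hm r (Finset.mem_of_mem_erase hr))
      refine ⟨a, ha, y, hy, fun r hr hyr => ?_⟩
      by_cases hrq : r = q
      · subst hrq
        exact hyS p (Finset.mem_erase.2 ⟨(Finset.ne_of_mem_erase hqS).symm, hpS⟩) (hq a y hy hyr)
      · exact hyS r (Finset.mem_erase.2 ⟨hrq, hr⟩) hyr
    · push Not at hq
      have hpp := hp p hpS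
      obtain ⟨a, ha, y, hy, hyS⟩ := ih (S.erase p)
        (by rw [Finset.card_erase_of_mem hpS]; omega)
        (fun r hr => hp r (Finset.mem_of_mem_erase hr))
        (fun r hr => hm r (Finset.mem_of_mem_erase hr))
      have key : ∀ T : Finset (Ideal A), T ⊆ S.erase p →
          ∃ b, 1 ≤ b ∧ ∃ z ∈ 𝒜 b, z ∉ p ∧ ∀ q ∈ T, z ∈ q := by
        intro T
        induction T using Finset.induction_on with
        | empty =>
          intro _
          obtain ⟨b, hb, w, hw, hwp⟩ := H.exists_hom_notMem (hm p hpS)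
          exact ⟨b, hb, w, hw, hwp, by simp⟩
        | insert q T hqT ihT =>
          intro hT
          obtain ⟨b, hb, z, hz, hzp, hzT⟩ := ihT ((Finset.subset_insert _ _).trans hT)
          obtain ⟨c, w, hw, hwq, hwp⟩ := hq q (hT (Finset.mem_insert_self _ _))
          refine ⟨b + c, by omega, z * w, SetLike.mul_mem_graded hz hw, ?_, ?_⟩
          · intro h
            rcases hpp.mem_or_mem h with h | h
            exacts [hzp h, hwp h]
          · intro r hr
            rcases Finset.mem_insert.1 hr with rfl | hr
            · exact Ideal.mul_mem_left _ _ hwq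
            · exact Ideal.mul_mem_right _ _ (hzT r hr)
      obtain ⟨b, hb, z, hz, hzp, hzS⟩ := key _ subset_rfl
      by_cases hyp : y ∈ p
      · refine ⟨b * a, Nat.mul_pos hb ha, y ^ b + z ^ a, ?_, ?_⟩
        · refine add_mem ?_ ?_
          · simpa using SetLike.pow_mem_graded b hy
          · have := SetLike.pow_mem_graded a hz
            simpa [mul_comm] using this
        · intro q hqS h
          by_cases hqp : q = p
          · subst hqp
            apply hzp
            apply hpp.mem_of_pow_mem a
            have := Ideal.pow_mem_of_mem q hyp b hb
            exact (Ideal.add_mem_iff_right _ this).1 h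
          · have hq' := Finset.mem_erase.2 ⟨hqp, hqS⟩
            apply hyS q hq'
            apply (hp q hqS).mem_of_pow_mem b
            have := Ideal.pow_mem_of_mem q (hzS q hq') a ha
            exact (Ideal.add_mem_iff_left _ this).1 h
      · refine ⟨a, ha, y, hy, fun q hqS h => ?_⟩
        by_cases hqp : q = p
        · subst hqp; exact hyp h
        · exact hyS q (Finset.mem_erase.2 ⟨hqp, hqS⟩) h

theorem StdGr.avoid (H : StdGr 𝒜 m) {S : Set (Ideal A)} (hS : S.Finite)
    (hp : ∀ p ∈ S, p.IsPrime) (hm : ∀ p ∈ S, ¬ m ≤ p) :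
    ∃ a, 1 ≤ a ∧ ∃ y ∈ 𝒜 a, ∀ p ∈ S, y ∉ p := by
  obtain ⟨a, ha, y, hy, h⟩ := H.avoid_aux _ hS.toFinset le_rfl (by simpa using hp) (by simpa using hm)
  exact ⟨a, ha, y, hy, by simpa using h⟩

variable (m) in
theorem sat_exists [IsNoetherianRing A] (c : Ideal A) :
    ∃ J : Ideal A, c ≤ J ∧ (∀ p ∈ associatedPrimes A (A ⧸ J), ¬ m ≤ p) ∧
      (∃ j, ∀ z ∈ J, z ∈ m ^ j → z ∈ c) ∧ ∀ z M, (∀ u ∈ m ^ M, u * z ∈ c) → z ∈ J := by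
  let F : ℕ → Ideal A := fun N =>
    { carrier := {z | ∀ u ∈ m ^ N, u * z ∈ c}
      add_mem' := fun {x y} hx hy u hu => by rw [mul_add]; exact add_mem (hx u hu) (hy u hu)
      zero_mem' := fun u _ => by simp
      smul_mem' := fun r x hx u hu => by
        rw [smul_eq_mul, mul_left_comm]; exact c.mul_mem_left _ (hx u hu) }
  have hF : ∀ N z, z ∈ F N ↔ ∀ u ∈ m ^ N, u * z ∈ c := fun _ _ => Iff.rfl
  have hmono : Monotone F := fun N M h z hz u hu => hz u (Ideal.pow_le_pow_right h hu)
  obtain ⟨N, hN⟩ := monotone_stabilizes_iff_noetherian.2 ‹IsNoetherianRing A› ⟨F, hmono⟩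
  have hN' : ∀ M, F M ≤ F N := fun M => by
    rcases le_total M N with h | h
    · exact hmono h
    · exact (hN M h).ge
  refine ⟨F N, fun z hz u _ => c.mul_mem_left _ hz, ?_, ?_, fun z M h => hN' M h⟩
  · refine ass_not_le m fun w hw => hN' (N + 1) ?_
    rw [hF]
    intro u hu
    rw [pow_succ] at hu
    refine Submodule.mul_induction_on hu (fun x hx y hy => ?_) (fun x y hx hy => ?_)
    · rw [mul_assoc]; exact hw y hy x hx
    · rw [add_mul]; exact add_mem hx hy
  · obtain ⟨k0, hk⟩ := Ideal.exists_pow_inf_eq_pow_smul m (M := A) (F N)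
    refine ⟨k0 + N, fun z hz hzm => ?_⟩
    have h1 : z ∈ (m ^ (k0 + N) • ⊤ ⊓ F N : Submodule A A) := by
      refine ⟨?_, hz⟩
      simpa using hzm
    rw [hk _ (Nat.le_add_right _ _), Nat.add_sub_cancel_left] at h1
    refine Submodule.smul_induction_on h1 (fun r hr x hx => ?_) (fun x y hx hy => add_mem hx hy)
    exact hx.2 r hr

end Graded

set_option synthInstance.maxHeartbeats 1000000
set_option maxHeartbeats 1000000

section Core
open DirectSum Polynomial

variable {k : Type} [Field k] {A : Type} [CommRing A] [Algebra k[X] A]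
  {𝒜 : ℕ → Submodule k[X] A} [GradedAlgebra 𝒜] {m : Ideal A}

variable (𝒜) in
/-- `f` is a nonzerodivisor modulo `J` in degrees at least `j`. -/
def NzHigh (j : ℕ) (f : A) (J : Ideal A) : Prop := ∀ d, j ≤ d → ∀ z ∈ 𝒜 d, f * z ∈ J → z ∈ J

theorem mem_sup_of_sub {J : Ideal A} {z f v : A} (h : z - f * v ∈ J) : z ∈ J ⊔ Ideal.span {f} := by
  have : z = (z - f * v) + f * v := by ring
  rw [this]
  exact add_mem (Ideal.mem_sup_left h)
    (Ideal.mem_sup_right (Ideal.mul_mem_right _ _ (Ideal.mem_span_singleton_self _)))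

theorem mem_sup_self' (J : Ideal A) (f v : A) : f * v ∈ J ⊔ Ideal.span {f} :=
  mem_sup_of_sub (v := v) (by simp)

theorem sup_span_pow_le (J : Ideal A) (f : A) (n : ℕ) :
    J ⊔ Ideal.span {f ^ (n + 1)} ≤ J ⊔ Ideal.span {f} := by
  refine sup_le_sup_left ?_ _
  rw [Ideal.span_singleton_le_span_singleton]
  exact dvd_pow_self _ (Nat.succ_ne_zero n)

theorem nz_perm {a : Ideal A} (ha : a.IsHomogeneous 𝒜) {j e : ℕ} {t f : A} (ht : t ∈ 𝒜 0)
    (hf : f ∈ 𝒜 e) (h0 : NzHigh 𝒜 j t a) (h2 : NzHigh 𝒜 j f (a ⊔ Ideal.span {t})) :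
    NzHigh 𝒜 (j + e) t (a ⊔ Ideal.span {f}) := by
  intro d hd z hz h
  have htz : t * z ∈ 𝒜 d := by simpa using SetLike.mul_mem_graded ht hz
  obtain ⟨w, hw, hwa⟩ := hom_split 𝒜 ha hf htz (d := d - e) (by omega) h
  have hw2 : w ∈ a ⊔ Ideal.span {t} := by
    refine h2 _ (by omega) w hw (mem_sup_of_sub (v := z) ?_)
    rw [← neg_sub]; exact neg_mem hwa
  obtain ⟨w', hw', hwa'⟩ := hom_split 𝒜 ha ht hw (d := d - e) (by omega) hw2
  refine mem_sup_of_sub (v := w') (h0 d (by omega) _ ?_ ?_)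
  · refine sub_mem hz ?_
    have := SetLike.mul_mem_graded hf hw'
    rwa [Nat.add_sub_cancel' (by omega)] at this
  · have : t * (z - f * w') = (t * z - f * w) + f * (w - t * w') := by ring
    rw [this]
    exact add_mem hwa (Ideal.mul_mem_left _ _ hwa')

theorem nz_pow_t {a : Ideal A} (ha : a.IsHomogeneous 𝒜) {j e : ℕ} {t f : A} (ht : t ∈ 𝒜 0)
    (hf : f ∈ 𝒜 e) (h0 : NzHigh 𝒜 j t a) (h2 : NzHigh 𝒜 j f (a ⊔ Ideal.span {t})) (n : ℕ) :
    NzHigh 𝒜 j f (a ⊔ Ideal.span {t ^ n}) := by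
  induction n with
  | zero => intro d _ z _ _; simp
  | succ n ih =>
    intro d hd z hz h
    have hz1 := h2 d hd z hz (sup_span_pow_le a t n h)
    obtain ⟨z', hz', hza⟩ := hom_split 𝒜 ha ht hz (d := d) (by omega) hz1
    have htn : t ^ (n + 1) ∈ 𝒜 0 := by simpa using SetLike.pow_mem_graded (n + 1) ht
    have htn' : t ^ n ∈ 𝒜 0 := by simpa using SetLike.pow_mem_graded n ht
    obtain ⟨v, hv, hva⟩ := hom_split 𝒜 ha htn (SetLike.mul_mem_graded hf hz)
      (d := e + d) (by omega) h
    have h3 : f * z' ∈ a ⊔ Ideal.span {t ^ n} := by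
      refine mem_sup_of_sub (v := v) (h0 (e + d) (by omega) _ ?_ ?_)
      · refine sub_mem (SetLike.mul_mem_graded hf hz') ?_
        simpa using SetLike.mul_mem_graded htn' hv
      · have : t * (f * z' - t ^ n * v) = (f * z - t ^ (n + 1) * v) - f * (z - t * z') := by ring
        rw [this]
        exact sub_mem hva (Ideal.mul_mem_left _ _ hza)
    obtain ⟨v', hv', hva'⟩ := hom_split 𝒜 ha htn' hz' (d := d) (by omega) (ih d hd z' hz' h3)
    refine mem_sup_of_sub (v := v') ?_
    have : z - t ^ (n + 1) * v' = (z - t * z') + t * (z' - t ^ n * v') := by ring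
    rw [this]
    exact add_mem hza (Ideal.mul_mem_left _ _ hva')

theorem nz_pow_f {J : Ideal A} {j e : ℕ} {f : A} (hf : f ∈ 𝒜 e)
    (h2 : NzHigh 𝒜 j f J) (n : ℕ) : NzHigh 𝒜 j (f ^ n) J := by
  induction n with
  | zero => intro d _ z _ h; simpa using h
  | succ n ih =>
    intro d hd z hz h
    refine h2 d hd z hz (ih (e + d) (by omega) _ (SetLike.mul_mem_graded hf hz) ?_)
    rwa [← mul_assoc, ← pow_succ]

theorem sat_t {a : Ideal A} (ha : a.IsHomogeneous 𝒜) {j e : ℕ} {t f : A} (ht : t ∈ 𝒜 0)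
    (hf : f ∈ 𝒜 e) (h0 : NzHigh 𝒜 j t a) (h2 : NzHigh 𝒜 j f (a ⊔ Ideal.span {t}))
    (h3 : ∀ d, j ≤ d → ∀ z ∈ 𝒜 d, ∀ M, Kills 𝒜 M z (a ⊔ Ideal.span {t} ⊔ Ideal.span {f}) →
      z ∈ a ⊔ Ideal.span {t} ⊔ Ideal.span {f}) (n : ℕ) :
    ∀ d, j ≤ d → ∀ z ∈ 𝒜 d, ∀ M, Kills 𝒜 M z (a ⊔ Ideal.span {t ^ n} ⊔ Ideal.span {f}) →
      z ∈ a ⊔ Ideal.span {t ^ n} ⊔ Ideal.span {f} := by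
  induction n with
  | zero => intro d _ z _ _ _; simp
  | succ n ih =>
    intro d hd z hz M hM
    have hz1 := h3 d hd z hz M (hM.mono le_rfl (sup_le_sup_right (sup_span_pow_le a t n) _))
    rw [sup_right_comm] at hz1 ⊢
    rw [sup_right_comm] at hM
    have haf := hom_sup_span 𝒜 ha hf
    have htn : t ^ (n + 1) ∈ 𝒜 0 := by simpa using SetLike.pow_mem_graded (n + 1) ht
    have htn' : t ^ n ∈ 𝒜 0 := by simpa using SetLike.pow_mem_graded n ht
    obtain ⟨z', hz', hza⟩ := hom_split 𝒜 haf ht hz (d := d) (by omega) hz1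
    have hk : Kills 𝒜 (M + e) z' (a ⊔ Ideal.span {t ^ n} ⊔ Ideal.span {f}) := by
      intro c hc u hu
      have h4 := hM c (by omega) u hu
      obtain ⟨v, hv, hva⟩ := hom_split 𝒜 haf htn (SetLike.mul_mem_graded hu hz)
        (d := c + d) (by omega) h4
      rw [sup_right_comm]
      refine mem_sup_of_sub (v := v) (nz_perm ha ht hf h0 h2 (c + d) (by omega) _ ?_ ?_)
      · refine sub_mem (SetLike.mul_mem_graded hu hz') ?_
        simpa using SetLike.mul_mem_graded htn' hv
      · have : t * (u * z' - t ^ n * v) = (u * z - t ^ (n + 1) * v) - u * (z - t * z') := by ring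
        rw [this]
        exact sub_mem hva (Ideal.mul_mem_left _ _ hza)
    have h5 := ih d hd z' hz' _ hk
    rw [sup_right_comm] at h5
    obtain ⟨v', hv', hva'⟩ := hom_split 𝒜 haf htn' hz' (d := d) (by omega) h5
    refine mem_sup_of_sub (v := v') ?_
    have : z - t ^ (n + 1) * v' = (z - t * z') + t * (z' - t ^ n * v') := by ring
    rw [this]
    exact add_mem hza (Ideal.mul_mem_left _ _ hva')

/-- F4 -/
theorem sat_div {J : Ideal A} (hJ : J.IsHomogeneous 𝒜) {j e : ℕ} {f : A}
    (hf : f ∈ 𝒜 e) (h2 : NzHigh 𝒜 j f J)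
    (h3 : ∀ d, j ≤ d → ∀ z ∈ 𝒜 d, ∀ M, Kills 𝒜 M z (J ⊔ Ideal.span {f}) →
      z ∈ J ⊔ Ideal.span {f}) (r : ℕ) :
    ∀ i z M, j ≤ i + e → z ∈ 𝒜 (i + r * e) → Kills 𝒜 M z (J ⊔ Ideal.span {f ^ r}) →
      ∃ z' ∈ 𝒜 i, z - f ^ r * z' ∈ J := by
  induction r with
  | zero => intro i z M _ hz _; exact ⟨z, by simpa using hz, by simp⟩
  | succ r ih =>
    intro i z M hi hz hk
    have hdeg : i + (r + 1) * e = e + (i + r * e) := by ring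
    have h4 : z ∈ J ⊔ Ideal.span {f} :=
      h3 _ (by rw [hdeg]; nlinarith [Nat.zero_le (r * e)]) z hz M (hk.mono le_rfl (sup_span_pow_le J f r))
    obtain ⟨z1, hz1, hzJ⟩ := hom_split 𝒜 hJ hf hz (d := i + r * e) hdeg h4
    have hfr : f ^ (r + 1) ∈ 𝒜 ((r + 1) * e) := by simpa using SetLike.pow_mem_graded (r + 1) hf
    have hfr' : f ^ r ∈ 𝒜 (r * e) := by simpa using SetLike.pow_mem_graded r hf
    obtain ⟨z', hz', hzJ'⟩ := ih i z1 (M + j) hi hz1 (by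
      intro c hc u hu
      obtain ⟨v, hv, hva⟩ := hom_split 𝒜 hJ hfr (SetLike.mul_mem_graded hu hz)
        (d := c + i) (by ring) (hk c (by omega) u hu)
      refine mem_sup_of_sub (v := v) (h2 (c + (i + r * e)) (by nlinarith [Nat.zero_le (r * e)]) _ ?_ ?_)
      · refine sub_mem (SetLike.mul_mem_graded hu hz1) ?_
        have := SetLike.mul_mem_graded hfr' hv
        rwa [show r * e + (c + i) = c + (i + r * e) by ring] at this
      · have : f * (u * z1 - f ^ r * v) = (u * z - f ^ (r + 1) * v) - u * (z - f * z1) := by ring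
        rw [this]
        exact sub_mem hva (Ideal.mul_mem_left _ _ hzJ))
    refine ⟨z', hz', ?_⟩
    have : z - f ^ (r + 1) * z' = (z - f * z1) + f * (z1 - f ^ r * z') := by ring
    rw [this]
    exact add_mem hzJ (Ideal.mul_mem_left _ _ hzJ')

/-- Artin–Rees step -/
theorem artin_rees_colon [IsNoetherianRing A] (b K : Ideal A) (t : A) :
    ∃ n : ℕ, 1 ≤ n ∧ ∀ q, (∀ u ∈ K, u * q ∈ b ⊔ Ideal.span {t ^ n}) →
      ∃ g, ∀ u ∈ K, u * (q - t * g) ∈ b := by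
  obtain ⟨G, hG⟩ : K.FG := IsNoetherian.noetherian K
  let L : A →ₗ[A] (G → A ⧸ b) :=
    LinearMap.pi fun g => (Submodule.mkQ b).comp (LinearMap.mulLeft A (g : A))
  have hL : ∀ q g, L q g = Submodule.mkQ b ((g : A) * q) := fun _ _ => rfl
  obtain ⟨n0, hn⟩ := Ideal.exists_pow_inf_eq_pow_smul (Ideal.span {t}) (LinearMap.range L)
  refine ⟨n0 + 1, by omega, fun q hq => ?_⟩
  have h1 : L q ∈ ((Ideal.span {t}) ^ (n0 + 1) • ⊤ ⊓ LinearMap.range L : Submodule A (G → A ⧸ b)) := by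
    refine ⟨?_, ⟨q, rfl⟩⟩
    have : ∀ g : G, ∃ v : A, (g : A) * q - t ^ (n0 + 1) * v ∈ b := by
      intro g
      have hg : (g : A) ∈ K := by rw [← hG]; exact Submodule.subset_span g.2
      obtain ⟨y, hy, w, hw, ee⟩ := Submodule.mem_sup.1 (hq g hg)
      obtain ⟨v, rfl⟩ := Ideal.mem_span_singleton'.1 hw
      refine ⟨v, ?_⟩
      rw [← ee]; convert hy using 1; ring
    choose v hv using this
    have e : L q = t ^ (n0 + 1) • (fun g => Submodule.mkQ b (v g)) := by
      funext g
      rw [hL, Pi.smul_apply, ← map_smul, ← sub_eq_zero, ← map_sub]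
      exact (Submodule.Quotient.mk_eq_zero b).2 (hv g)
    rw [e]
    exact Submodule.smul_mem_smul (Ideal.pow_mem_pow (Ideal.mem_span_singleton_self t) _) trivial
  rw [hn _ (by omega), Nat.add_sub_cancel_left, pow_one] at h1
  have h2 : ∃ g, L q = L (t * g) := by
    refine Submodule.smul_induction_on (p := fun x => ∃ g, x = L (t * g)) h1 ?_ ?_
    · rintro r hr x ⟨_, g, rfl⟩
      obtain ⟨s, rfl⟩ := Ideal.mem_span_singleton'.1 hr
      refine ⟨s * g, ?_⟩
      rw [← map_smul]; congr 1; simp only [smul_eq_mul]; ring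
    · rintro x y ⟨g, rfl⟩ ⟨h, rfl⟩
      exact ⟨g + h, by rw [mul_add, map_add]⟩
  obtain ⟨g, hg⟩ := h2
  refine ⟨g, fun u hu => ?_⟩
  rw [← hG] at hu
  refine Submodule.span_induction (p := fun u _ => u * (q - t * g) ∈ b) ?_ ?_ ?_ ?_ hu
  · intro x hx
    have := congrFun hg ⟨x, hx⟩
    rw [hL, hL, ← sub_eq_zero, ← map_sub] at this
    rw [mul_sub]
    exact (Submodule.Quotient.mk_eq_zero b).1 this
  · simp
  · intro x y _ _ hx hy
    rw [add_mul]; exact add_mem hx hy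
  · intro c x _ hx
    rw [smul_eq_mul, mul_assoc]; exact b.mul_mem_left _ hx

end Core

set_option synthInstance.maxHeartbeats 1000000
set_option maxHeartbeats 1000000
set_option linter.unusedSectionVars false

section Core2
open DirectSum Polynomial

variable {k : Type} [Field k] {A : Type} [CommRing A] [Algebra k[X] A]
  {𝒜 : ℕ → Submodule k[X] A} [GradedAlgebra 𝒜] {m : Ideal A}

variable (k A) in
/-- the image of the nonzero polynomials in the parameter -/
noncomputable def WR : Submonoid A := Submonoid.map (algebraMap k[X] A) (nonZeroDivisors k[X])

theorem mem_WR {z : A} : z ∈ WR k A ↔ ∃ r : k[X], r ≠ 0 ∧ algebraMap k[X] A r = z := by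
  simp [WR, Submonoid.mem_map, mem_nonZeroDivisors_iff_ne_zero]

variable (k A) in
noncomputable abbrev tt : A := algebraMap k[X] A X

variable (𝒜) in
theorem tt_mem : tt k A ∈ 𝒜 0 := SetLike.algebraMap_mem_graded 𝒜 X

theorem NzHigh.mono {j j' : ℕ} {f : A} {J : Ideal A} (h : NzHigh 𝒜 j f J) (hj : j ≤ j') :
    NzHigh 𝒜 j' f J := fun d hd => h d (hj.trans hd)

theorem wReg_pow {W : Submonoid A} {a : Ideal A} {y : A} (h : wReg W a y) (r : ℕ) :
    wReg W a (y ^ r) := by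
  induction r with
  | zero => intro z hz; simpa using hz
  | succ r ih =>
    intro z hz
    refine h z (ih _ ?_)
    rwa [← mul_assoc, ← pow_succ]

theorem unit_mod_X (r : k[X]) (h : ¬ X ∣ r) : ∃ s w : k[X], r * s = 1 + X * w := by
  have h0 : r.coeff 0 ≠ 0 := by rwa [Ne, ← X_dvd_iff]
  obtain ⟨w, hw⟩ : X ∣ r * C (r.coeff 0)⁻¹ - 1 := by
    rw [X_dvd_iff]; simp [h0]
  exact ⟨C (r.coeff 0)⁻¹, w, by rw [← hw]; ring⟩

theorem pow_sup_le (a : Ideal A) (t : A) (n : ℕ) :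
    (a ⊔ Ideal.span {t}) ^ n ≤ a ⊔ Ideal.span {t ^ n} := by
  induction n with
  | zero => simp
  | succ n ih =>
    rw [pow_succ]
    refine (Ideal.mul_mono_left ih).trans ?_
    rw [Ideal.mul_le]
    intro x hx y hy
    obtain ⟨x1, hx1, x2, hx2, rfl⟩ := Submodule.mem_sup.1 hx
    obtain ⟨y1, hy1, y2, hy2, rfl⟩ := Submodule.mem_sup.1 hy
    obtain ⟨v, rfl⟩ := Ideal.mem_span_singleton'.1 hx2
    obtain ⟨w, rfl⟩ := Ideal.mem_span_singleton'.1 hy2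
    refine mem_sup_of_sub (v := v * w) ?_
    have : (x1 + v * t ^ n) * (y1 + w * t) - t ^ (n + 1) * (v * w) =
      (y1 + w * t) * x1 + v * t ^ n * y1 := by ring
    rw [this]
    exact add_mem (a.mul_mem_left _ hx1) (a.mul_mem_left _ hy1)

/-- division by the parameter -/
theorem div_t {a : Ideal A} {j D : ℕ} (h0 : NzHigh 𝒜 j (tt k A) a) (hD : j ≤ D)
    {q y : A} (hq : q ∈ 𝒜 D) (hy : y ∈ 𝒜 D) : ∀ (N : ℕ) (μ l : k[X]), μ.natDegree ≤ N → μ ≠ 0 →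
    algebraMap k[X] A μ * q - algebraMap k[X] A l * y ∈ a →
    ∃ μ l : k[X], ¬ (X ∣ μ ∧ X ∣ l) ∧
      algebraMap k[X] A μ * q - algebraMap k[X] A l * y ∈ a := by
  intro N
  induction N with
  | zero =>
    intro μ l hμ hμ0 h
    refine ⟨μ, l, fun ⟨h1, _⟩ => ?_, h⟩
    have := natDegree_le_of_dvd h1 hμ0
    rw [natDegree_X] at this
    omega
  | succ N ih =>
    intro μ l hμ hμ0 h
    by_cases hX : X ∣ μ ∧ X ∣ l
    · obtain ⟨⟨μ', rfl⟩, l', rfl⟩ := hX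
      have hμ' : μ' ≠ 0 := right_ne_zero_of_mul hμ0
      refine ih μ' l' ?_ hμ' (h0 D hD _ ?_ ?_)
      · rw [natDegree_mul X_ne_zero hμ', natDegree_X] at hμ; omega
      · refine sub_mem ?_ ?_
        · rw [← Algebra.smul_def]; exact Submodule.smul_mem _ _ hq
        · rw [← Algebra.smul_def]; exact Submodule.smul_mem _ _ hy
      · have : tt k A * (algebraMap k[X] A μ' * q - algebraMap k[X] A l' * y) =
          algebraMap k[X] A (X * μ') * q - algebraMap k[X] A (X * l') * y := by
          rw [map_mul, map_mul]; ring
        rwa [this]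
    · exact ⟨μ, l, hX, h⟩

theorem exists_prime_of_not_le_radical {b : Ideal A} (h : ¬ m ≤ b.radical) :
    ∃ p : Ideal A, p.IsPrime ∧ b ≤ p ∧ ¬ m ≤ p := by
  by_contra hcon
  push Not at hcon
  apply h
  rw [Ideal.radical_eq_sInf]
  exact le_sInf fun p hp => hcon p hp.2 hp.1

theorem core [IsNoetherianRing A] (H : StdGr 𝒜 m) {a b c : Ideal A} (ha : a.IsHomogeneous 𝒜)
    (hb : b.IsHomogeneous 𝒜) (hc : c.IsHomogeneous 𝒜) (htb : tt k A ∈ b) (htc : tt k A ∈ c)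
    (hab : a ≤ b) (hac : a ≤ c) (hbc : b * c ≤ (a ⊔ Ideal.span {tt k A}).radical)
    (hm : m ≤ (b ⊔ c).radical) (hmb : ¬ m ≤ b.radical) (hmc : ¬ m ≤ c.radical)
    (hD : wDp (WR k A) m 2 a) {j0 : ℕ} (h0 : NzHigh 𝒜 j0 (tt k A) a) : False := by
  obtain ⟨pb, hpb, hbpb, hmpb⟩ := exists_prime_of_not_le_radical hmb
  obtain ⟨pc, hpc, hcpc, hmpc⟩ := exists_prime_of_not_le_radical hmc
  set t : A := tt k A with ht_def
  have ht : t ∈ 𝒜 0 := tt_mem 𝒜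
  obtain ⟨J1, hJ1, hJ1ass, ⟨j1, hj1⟩, -⟩ := sat_exists m (a ⊔ Ideal.span {t})
  obtain ⟨e, he, y, hy, hyS⟩ := H.avoid
    (S := associatedPrimes A (A ⧸ wCl (WR k A) a) ∪ (associatedPrimes A (A ⧸ J1) ∪ {pb, pc}))
    ((associatedPrimes.finite A _).union ((associatedPrimes.finite A _).union (by simp)))
    (by
      rintro p (hp | hp | rfl | rfl)
      exacts [hp.isPrime, hp.isPrime, hpb, hpc])
    (by
      obtain ⟨x, hx, hxr, -⟩ := hD
      rintro p (hp | hp | rfl | rfl)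
      exacts [wAss_not_le _ m hx hxr p hp, hJ1ass p hp, hmpb, hmpc])
  have hyreg : wReg (WR k A) a y := wReg_of_notMem _ fun p hp => hyS p (Or.inl hp)
  have hypb : y ∉ pb := hyS pb (by simp)
  have hypc : y ∉ pc := hyS pc (by simp)
  obtain ⟨J2, -, -, ⟨j2, hj2⟩, hJ2⟩ := sat_exists m (a ⊔ Ideal.span {t} ⊔ Ideal.span {y})
  set j := max j0 (max j1 j2) with hj
  have F0 : NzHigh 𝒜 j t a := h0.mono (le_max_left _ _)
  have F2 : NzHigh 𝒜 j y (a ⊔ Ideal.span {t}) := by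
    intro d hd z hz h
    refine hj1 z (reg_of_notMem_ass (fun p hp => hyS p (Or.inr (Or.inl hp))) z (hJ1 h)) ?_
    exact H.mem_pow hz (by omega)
  have F3 : ∀ d, j ≤ d → ∀ z ∈ 𝒜 d, ∀ M, Kills 𝒜 M z (a ⊔ Ideal.span {t} ⊔ Ideal.span {y}) →
      z ∈ a ⊔ Ideal.span {t} ⊔ Ideal.span {y} := by
    intro d hd z hz M hM
    exact hj2 z (hJ2 z M (H.kills_pow hM)) (H.mem_pow hz (by omega))
  have F2n := nz_pow_t ha ht hy F0 F2
  have F3n := sat_t ha ht hy F0 F2 F3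
  have hyj : ∀ r, y ^ r ∈ 𝒜 (r * e) := fun r => by simpa using SetLike.pow_mem_graded r hy
  have hje : j ≤ j * e := Nat.le_mul_of_pos_right j he
  have hym : y ∈ m := by simpa using H.mem_pow hy he
  obtain ⟨n, hn1, hn⟩ := artin_rees_colon (a ⊔ Ideal.span {y ^ j}) (m ^ j) t
  have htn : t ^ n ∈ 𝒜 0 := by simpa using SetLike.pow_mem_graded n ht
  have hJn := hom_sup_span 𝒜 ha htn
  have F4 := fun r => sat_div hJn hy (F2n n) (F3n n) r
  -- decomposition of a power of y
  obtain ⟨N0, hN0⟩ := Ideal.exists_pow_le_of_le_radical_of_fg hbc (IsNoetherian.noetherian _)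
  have hbcN : (b * c) ^ ((N0 + 1) * n) ≤ a ⊔ Ideal.span {t ^ n} := by
    refine le_trans ?_ (pow_sup_le a t n)
    rw [pow_mul]
    exact Ideal.pow_right_mono ((Ideal.pow_le_pow_right (Nat.le_succ _)).trans hN0) n
  set N := (N0 + 1) * n with hN
  have hN1 : N ≠ 0 := by positivity
  have hmN : m ≤ (b ^ N ⊔ c ^ N).radical := by
    refine hm.trans ?_
    rw [Ideal.radical_le_radical_iff]
    refine sup_le (fun x hx => ?_) (fun x hx => ?_)
    · exact ⟨N, Ideal.mem_sup_left (Ideal.pow_mem_pow hx N)⟩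
    · exact ⟨N, Ideal.mem_sup_right (Ideal.pow_mem_pow hx N)⟩
  obtain ⟨M, hM⟩ := Ideal.exists_pow_le_of_le_radical_of_fg hmN (IsNoetherian.noetherian _)
  set s := M + j with hs
  have hysM : y ^ s ∈ b ^ N ⊔ c ^ N :=
    hM (Ideal.pow_le_pow_right (by omega) (Ideal.pow_mem_pow hym s))
  obtain ⟨β, hβ, γ, hγ, hβd, hγd, hβγ⟩ := hom_split2 𝒜 (hom_pow 𝒜 hb N) (hom_pow 𝒜 hc N) (hyj s) hysM
  have hkβ : Kills 𝒜 M β (a ⊔ Ideal.span {t ^ n} ⊔ Ideal.span {y ^ s}) := by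
    intro d hd u hu
    obtain ⟨u1, hu1, u2, hu2, rfl⟩ := Submodule.mem_sup.1 (hM (H.mem_pow hu hd))
    refine mem_sup_of_sub (v := u1) ?_
    have : (u1 + u2) * β - y ^ s * u1 = β * u2 - u1 * γ := by rw [hβγ]; ring
    rw [this]
    refine sub_mem (hbcN ?_) (hbcN ?_) <;> rw [mul_pow]
    · exact Ideal.mul_mem_mul hβ hu2
    · exact Ideal.mul_mem_mul hu1 hγ
  obtain ⟨q, hq, hqβ⟩ := F4 M (j * e) β M (by omega)
    (by convert hβd using 2; rw [hs]; ring)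
    (hkβ.mono le_rfl (sup_le_sup_left (by
      rw [Ideal.span_singleton_le_span_singleton]; exact pow_dvd_pow y (by omega)) _))
  have hkq : Kills 𝒜 (M + j) q (a ⊔ Ideal.span {t ^ n} ⊔ Ideal.span {y ^ j}) := by
    intro d hd u hu
    obtain ⟨v, hv, hva⟩ := hom_split 𝒜 hJn (hyj s) (SetLike.mul_mem_graded hu hβd)
      (d := d) (by ring) (hkβ d (by omega) u hu)
    refine mem_sup_of_sub (v := v) (nz_pow_f hy (F2n n) M (d + j * e) (by omega) _ ?_ ?_)
    · refine sub_mem (SetLike.mul_mem_graded hu hq) ?_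
      have := SetLike.mul_mem_graded (hyj j) hv
      rwa [add_comm] at this
    · have : y ^ M * (u * q - y ^ j * v) = (u * β - y ^ s * v) - u * (β - y ^ M * q) := by
        rw [hs]; ring
      rw [this]
      exact sub_mem hva (Ideal.mul_mem_left _ _ hqβ)
  have hkq2 : Kills 𝒜 j q (a ⊔ Ideal.span {y ^ j} ⊔ Ideal.span {t ^ n}) := by
    intro d hd u hu
    obtain ⟨z', hz', hz''⟩ := F4 j d (u * q) (M + j) (by omega) (SetLike.mul_mem_graded hu hq) (by
      intro d' hd' u' hu'
      rw [mul_left_comm]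
      exact Ideal.mul_mem_left _ _ (hkq d' hd' u' hu'))
    rw [sup_right_comm]
    exact mem_sup_of_sub hz''
  obtain ⟨g, hg⟩ := hn q (H.kills_pow hkq2)
  have haj := hom_sup_span 𝒜 ha (hyj j)
  -- homogenise
  set g' : A := (decompose 𝒜 g (j * e) : A) with hg'
  have hg'm : g' ∈ 𝒜 (j * e) := SetLike.coe_mem _
  set q' := q - t * g' with hq'
  have htg' : t * g' ∈ 𝒜 (j * e) := by simpa using SetLike.mul_mem_graded ht hg'm
  have hq'm : q' ∈ 𝒜 (j * e) := sub_mem hq htg'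
  have hkq' : Kills 𝒜 j q' (a ⊔ Ideal.span {y ^ j}) := by
    intro d hd u hu
    have h1 := haj (d + j * e) (hg u (H.mem_pow hu hd))
    rw [coe_decompose_mul_add_of_left_mem 𝒜 hu, decompose_sub, DirectSum.sub_apply,
      Submodule.coe_sub, decompose_of_mem_same 𝒜 hq] at h1
    have h2 : (decompose 𝒜 (t * g) (j * e) : A) = t * g' := by
      have := coe_decompose_mul_add_of_left_mem 𝒜 (b := g) (j := j * e) ht
      rwa [zero_add] at this
    rw [h2] at h1
    exact h1
  obtain ⟨x, hx, hxr, -⟩ := wDp_exchange (WR k A) m 1 a (y ^ j) hD (wReg_pow hyreg j)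
  have hqcl : q' ∈ wCl (WR k A) (a ⊔ Ideal.span {y ^ j}) :=
    wReg_pow hxr j q' (le_wCl _ _ (H.kills_pow hkq' _ (Ideal.pow_mem_pow hx j)))
  obtain ⟨ρ, hρ, hρq⟩ := hqcl
  obtain ⟨μ, hμ, rfl⟩ := mem_WR.1 hρ
  have hμq : algebraMap k[X] A μ * q' ∈ 𝒜 (j * e) := by
    rw [← Algebra.smul_def]; exact Submodule.smul_mem _ _ hq'm
  obtain ⟨v, hv, hva⟩ := hom_split 𝒜 ha (hyj j) hμq (d := 0) (by omega) hρq
  obtain ⟨l, rfl⟩ := H.h0 v hv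
  rw [mul_comm (y ^ j)] at hva
  obtain ⟨μ', l', hX, h5⟩ := div_t F0 hje hq'm (hyj j) _ μ l le_rfl hμ hva
  have hat : ∀ {z v : A}, z - t * v ∈ a → z ∈ b := fun {z v} h => by
    have : z = (z - t * v) + t * v := by ring
    rw [this]; exact add_mem (hab h) (b.mul_mem_right _ htb)
  have hpbpow : ∀ r, y ^ r ∉ b := fun r h => hypb (hpb.mem_of_pow_mem r (hbpb h))
  by_cases hXμ : X ∣ μ'
  · have hXl : ¬ X ∣ l' := fun h => hX ⟨hXμ, h⟩
    obtain ⟨μ'', rfl⟩ := hXμ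
    obtain ⟨σ, w, hσ⟩ := unit_mod_X l' hXl
    have hσ' := congrArg (algebraMap k[X] A) hσ
    simp only [map_mul, map_add, map_one] at hσ' h5
    refine hpbpow j (hat (v := algebraMap k[X] A σ * algebraMap k[X] A μ'' * q' -
      algebraMap k[X] A w * y ^ j) ?_)
    have : y ^ j - t * (algebraMap k[X] A σ * algebraMap k[X] A μ'' * q' -
      algebraMap k[X] A w * y ^ j) = - algebraMap k[X] A σ *
        (algebraMap k[X] A X * algebraMap k[X] A μ'' * q' - algebraMap k[X] A l' * y ^ j) := by
      linear_combination (-(y ^ j)) * hσ'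
    rw [this]
    exact a.mul_mem_left _ h5
  · obtain ⟨σ, w, hσ⟩ := unit_mod_X μ' hXμ
    have hσ' := congrArg (algebraMap k[X] A) hσ
    simp only [map_mul, map_add, map_one] at hσ'
    -- q ≡ σ l' y^j mod a + t
    have h6 : ∀ K : Ideal A, a ≤ K → t ∈ K → q - algebraMap k[X] A σ * algebraMap k[X] A l' * y ^ j ∈ K := by
      intro K haK htK
      have : q - algebraMap k[X] A σ * algebraMap k[X] A l' * y ^ j =
        algebraMap k[X] A σ * (algebraMap k[X] A μ' * q' - algebraMap k[X] A l' * y ^ j)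
          + (g' - algebraMap k[X] A w * q') * t := by
        rw [hq'] at *
        linear_combination (-(q - t * g')) * hσ'
      rw [this]
      exact add_mem (K.mul_mem_left _ (haK h5)) (K.mul_mem_left _ htK)
    have h7 : ∀ K : Ideal A, a ≤ K → t ∈ K → β - y ^ M * q ∈ K := by
      intro K haK htK
      refine (sup_le haK ?_) hqβ
      rw [Ideal.span_singleton_le_iff_mem]
      exact K.pow_mem_of_mem htK n (by omega)
    by_cases hXl : X ∣ l'
    · obtain ⟨l'', rfl⟩ := hXl
      have hβc : β ∈ c := by
        have : β = (β - y ^ M * q) + (y ^ M * (q - algebraMap k[X] A σ * algebraMap k[X] A (X * l'') * y ^ j)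
          + y ^ M * algebraMap k[X] A σ * algebraMap k[X] A l'' * y ^ j * t) := by
          rw [map_mul]; ring
        rw [this]
        exact add_mem (h7 c hac htc) (add_mem (c.mul_mem_left _ (h6 c hac htc)) (c.mul_mem_left _ htc))
      apply hypc
      apply hpc.mem_of_pow_mem s
      apply hcpc
      rw [hβγ]
      exact add_mem hβc (Ideal.pow_le_self hN1 hγ)
    · obtain ⟨τ, w', hτ⟩ := unit_mod_X l' hXl
      have hτ' := congrArg (algebraMap k[X] A) hτ
      simp only [map_mul, map_add, map_one] at hτ'
      have hβb : β ∈ b := Ideal.pow_le_self hN1 hβ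
      apply hpbpow s
      have : y ^ s = algebraMap k[X] A μ' * algebraMap k[X] A τ * (β - (β - y ^ M * q)
        - y ^ M * (q - algebraMap k[X] A σ * algebraMap k[X] A l' * y ^ j))
        - (algebraMap k[X] A w + algebraMap k[X] A w' + t * algebraMap k[X] A w * algebraMap k[X] A w')
          * y ^ s * t := by
        rw [hs, pow_add]
        linear_combination (-(y ^ M * y ^ j) * algebraMap k[X] A l' * algebraMap k[X] A τ) * hσ' - (y ^ M * y ^ j * (1 + t * algebraMap k[X] A w)) * hτ'
      rw [this]
      exact sub_mem (b.mul_mem_left _ (sub_mem (sub_mem hβb (h7 b hab htb))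
        (b.mul_mem_left _ (h6 b hab htb)))) (b.mul_mem_left _ htb)

end Core2

set_option synthInstance.maxHeartbeats 1000000
set_option maxHeartbeats 1000000
set_option linter.unusedSectionVars false

section Chains
variable {A : Type} [CommRing A]

/-- a chain of primes of length `n` above `J` ending in `x` -/
def Ch (x : PrimeSpectrum A) (J : Ideal A) (n : ℕ) : Prop :=
  ∃ p : LTSeries (PrimeSpectrum A), p.length = n ∧ J ≤ p.head.asIdeal ∧ p.last = x

theorem Ch_zero {x : PrimeSpectrum A} {J : Ideal A} (h : J ≤ x.asIdeal) : Ch x J 0 :=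
  ⟨RelSeries.singleton _ x, rfl, h, rfl⟩

theorem Ch_succ {x : PrimeSpectrum A} {J J' : Ideal A} {n : ℕ} (h : Ch x J n) (hJ : J' ≤ J)
    (h2 : ∀ p ∈ J'.minimalPrimes, ¬ J ≤ p) : Ch x J' (n + 1) := by
  obtain ⟨p, hp, hJp, hx⟩ := h
  obtain ⟨q, hq, hqp⟩ := Ideal.exists_minimalPrimes_le (hJ.trans hJp)
  let q' : PrimeSpectrum A := ⟨q, hq.isPrime⟩
  have hlt : q' < p.head := by
    refine lt_of_le_of_ne hqp ?_
    intro e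
    apply h2 q hq
    rw [← e] at hJp
    exact hJp
  refine ⟨p.cons q' hlt, ?_, ?_, ?_⟩
  · show 0 + p.length + 1 = n + 1
    omega
  · rw [RelSeries.head_cons]; exact hq.1.2
  · rw [RelSeries.last_cons]; exact hx

theorem Ch_lt {x : PrimeSpectrum A} {J : Ideal A} {n : ℕ} (h : Ch x J (n + 1)) :
    ∃ p : PrimeSpectrum A, J ≤ p.asIdeal ∧ p < x := by
  obtain ⟨p, hp, hJp, hx⟩ := h
  refine ⟨p.head, hJp, ?_⟩
  rw [← hx]
  refine p.strictMono ?_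
  rw [Fin.lt_def]
  simp [hp]

theorem Ch_cut [IsNoetherianRing A] {x : PrimeSpectrum A} {J : Ideal A} {n : ℕ}
    (h : Ch x J (n + 1)) {f : A} (hf : f ∈ x.asIdeal) : Ch x (J ⊔ Ideal.span {f}) n := by
  obtain ⟨p, hp, hJp, hx⟩ := h
  have hJx : J ≤ x.asIdeal := by
    refine hJp.trans ?_
    rw [← hx]
    exact p.monotone (Fin.zero_le _)
  let π := Ideal.Quotient.mk J
  have hker : ∀ q : Ideal A, J ≤ q → (q.map π).comap π = q := fun q hq => by
    rw [Ideal.comap_map_of_surjective _ Ideal.Quotient.mk_surjective, ← RingHom.ker_eq_comap_bot,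
      Ideal.mk_ker]
    exact sup_eq_left.2 hq
  have hpr : ∀ q : Ideal A, q.IsPrime → J ≤ q → (q.map π).IsPrime := fun q hq hJq => by
    exact Ideal.isPrime_map_quotientMk_of_isPrime hJq
  have hpi : ∀ i, J ≤ (p i).asIdeal := fun i => hJp.trans (p.monotone (Fin.zero_le _))
  let x' : PrimeSpectrum (A ⧸ J) := ⟨x.asIdeal.map π, hpr _ x.2 hJx⟩
  have h1 : ((n + 1 : ℕ) : ℕ∞) ≤ x'.asIdeal.height := by
    rw [PrimeSpectrum.height_eq_orderHeight]
    let p' : LTSeries (PrimeSpectrum (A ⧸ J)) := LTSeries.mk p.length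
      (fun i => ⟨(p i).asIdeal.map π, hpr _ (p i).2 (hpi i)⟩) (by
        intro i j hij
        refine lt_of_le_of_ne (Ideal.map_mono (p.monotone hij.le)) ?_
        intro e
        have e' := congrArg (fun q : PrimeSpectrum (A ⧸ J) => q.asIdeal.comap π) e
        simp only [hker _ (hpi _)] at e'
        exact (p.strictMono hij).ne (PrimeSpectrum.ext e'))
    have hl : p'.last ≤ x' := by
      have : p (Fin.last p.length) = x := hx
      show (p (Fin.last p.length)).asIdeal.map π ≤ x.asIdeal.map π
      rw [this]
    have := Order.length_le_height hl
    have e : p'.length = n + 1 := hp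
    rwa [e] at this
  let f' := π f
  have hf' : f' ∈ x'.asIdeal := Ideal.mem_map_of_mem _ hf
  have := x'.2
  have h2 := h1.trans (Ideal.height_le_height_add_one_of_mem hf')
  let π2 := Ideal.Quotient.mk (Ideal.span {f'})
  have hfx' : Ideal.span {f'} ≤ x'.asIdeal := by rwa [Ideal.span_singleton_le_iff_mem]
  let x'' : PrimeSpectrum ((A ⧸ J) ⧸ Ideal.span {f'}) :=
    ⟨x'.asIdeal.map π2, Ideal.isPrime_map_quotientMk_of_isPrime hfx'⟩
  have h3 : (n : ℕ∞) ≤ Order.height x'' := by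
    rw [← PrimeSpectrum.height_eq_orderHeight]
    push_cast at h2
    exact (ENat.add_le_add_iff_right (by simp)).1 h2
  obtain ⟨r, hr, hrn⟩ := Order.exists_series_of_le_height x'' h3
  let φ : A →+* (A ⧸ J) ⧸ Ideal.span {f'} := π2.comp π
  have hφ : Function.Surjective φ := Ideal.Quotient.mk_surjective.comp Ideal.Quotient.mk_surjective
  have hmono : StrictMono (PrimeSpectrum.comap φ) := by
    refine Monotone.strictMono_of_injective (fun a b hab => Ideal.comap_mono hab) ?_
    exact PrimeSpectrum.comap_injective_of_surjective φ hφ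
  refine ⟨r.map _ hmono, hrn, ?_, ?_⟩
  · rw [LTSeries.head_map]
    refine sup_le ?_ ?_
    · intro a ha
      show φ a ∈ (RelSeries.head r).asIdeal
      have : φ a = 0 := by
        show π2 (π a) = 0
        rw [Ideal.Quotient.eq_zero_iff_mem.2 ha, map_zero]
      rw [this]; exact zero_mem _
    · rw [Ideal.span_singleton_le_iff_mem]
      show φ f ∈ (RelSeries.head r).asIdeal
      have : φ f = 0 := by
        show π2 f' = 0
        exact Ideal.Quotient.eq_zero_iff_mem.2 (Ideal.mem_span_singleton_self _)
      rw [this]; exact zero_mem _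
  · rw [LTSeries.last_map, hr]
    ext1
    show Ideal.comap φ _ = _
    rw [← Ideal.comap_comap]
    show Ideal.comap π (Ideal.comap π2 (x'.asIdeal.map π2)) = _
    rw [Ideal.comap_map_of_surjective _ Ideal.Quotient.mk_surjective, ← RingHom.ker_eq_comap_bot,
      Ideal.mk_ker, sup_eq_left.2 hfx']
    exact hker _ hJx
end Chains

section Claims
open DirectSum Polynomial

variable {k : Type} [Field k] {A : Type} [CommRing A] [Algebra k[X] A]
  {𝒜 : ℕ → Submodule k[X] A} [GradedAlgebra 𝒜] {m : Ideal A}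

theorem minPrimes_hom {J : Ideal A} (hJ : J.IsHomogeneous 𝒜) {p : Ideal A}
    (hp : p ∈ J.minimalPrimes) : p.IsHomogeneous 𝒜 := by
  have h1 := Ideal.IsPrime.homogeneousCore (𝒜 := 𝒜) hp.isPrime
  have h2 : J ≤ (p.homogeneousCore 𝒜).toIdeal := by
    rw [← hJ.toIdeal_homogeneousCore_eq_self]
    exact Ideal.homogeneousCore_mono 𝒜 hp.1.2
  have h3 := hp.2 ⟨h1, h2⟩ (Ideal.toIdeal_homogeneousCore_le 𝒜 p)
  rw [le_antisymm h3 (Ideal.toIdeal_homogeneousCore_le 𝒜 p)]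
  exact (p.homogeneousCore 𝒜).isHomogeneous

theorem StdGr.hom_prime_le (H : StdGr 𝒜 m) {x : PrimeSpectrum A}
    (hx : x.asIdeal = m ⊔ Ideal.span {tt k A}) {p : Ideal A} (hp : p ≠ ⊤)
    (hph : p.IsHomogeneous 𝒜) (ht : tt k A ∈ p) : p ≤ x.asIdeal := by
  classical
  intro z hz
  rw [hx, ← sum_support_decompose 𝒜 z]
  refine Ideal.sum_mem _ fun i _ => ?_
  rcases Nat.eq_zero_or_pos i with rfl | hi
  · obtain ⟨r, hr⟩ := H.h0 _ (SetLike.coe_mem (decompose 𝒜 z 0))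
    have hrp : algebraMap k[X] A r ∈ p := hr ▸ hph 0 hz
    rw [← hr]
    by_cases hX : X ∣ r
    · obtain ⟨s, rfl⟩ := hX
      rw [map_mul]
      exact mem_sup_self' _ _ _
    · exfalso
      obtain ⟨s, w, hsw⟩ := unit_mod_X r hX
      apply hp
      rw [Ideal.eq_top_iff_one]
      have := congrArg (algebraMap k[X] A) hsw
      simp only [map_mul, map_add, map_one] at this
      have e : (1 : A) = algebraMap k[X] A r * algebraMap k[X] A s - tt k A * algebraMap k[X] A w := by
        rw [this]; ring
      rw [e]
      exact sub_mem (p.mul_mem_right _ hrp) (p.mul_mem_right _ ht)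
  · refine Ideal.mem_sup_left ?_
    simpa using H.mem_pow (SetLike.coe_mem (decompose 𝒜 z i)) (j := 1) hi

theorem StdGr.min_not_le (H : StdGr 𝒜 m) {x : PrimeSpectrum A}
    (hx : x.asIdeal = m ⊔ Ideal.span {tt k A}) {J : Ideal A} (hJ : J.IsHomogeneous 𝒜)
    (ht : tt k A ∈ J) (hm : ¬ m ≤ J.radical) : ∀ p ∈ J.minimalPrimes, ¬ m ≤ p := by
  intro p hp hmp
  have hxp : x.asIdeal ≤ p := by
    rw [hx]; exact sup_le hmp (by rw [Ideal.span_singleton_le_iff_mem]; exact hp.1.2 ht)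
  apply hm
  rw [← Ideal.sInf_minimalPrimes]
  refine le_sInf fun q hq => ?_
  have hqx := H.hom_prime_le hx hq.isPrime.ne_top (minPrimes_hom hJ hq) (hq.1.2 ht)
  have := hp.2 hq.1 (hqx.trans hxp)
  exact hmp.trans this

theorem sup3 (b c d : Ideal A) : b ⊔ d ⊔ (c ⊔ d) = b ⊔ c ⊔ d := by
  rw [sup_sup_sup_comm, sup_idem]

theorem wDp_mono {W : Submonoid A} {d d' : ℕ} (h : d ≤ d') {a : Ideal A} (hd : wDp W m d' a) :
    wDp W m d a := by
  induction d generalizing d' a with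
  | zero => trivial
  | succ d ih =>
    obtain ⟨e, rfl⟩ : ∃ e, d' = e + 1 := ⟨d' - 1, by omega⟩
    obtain ⟨x, hx, h1, h2⟩ := hd
    exact ⟨x, hx, h1, ih (by omega) h2⟩

theorem claimT_base [IsNoetherianRing A] (H : StdGr 𝒜 m) {x : PrimeSpectrum A}
    (hx : x.asIdeal = m ⊔ Ideal.span {tt k A}) {a b c : Ideal A}
    (ha : a.IsHomogeneous 𝒜) (hb : b.IsHomogeneous 𝒜) (hc : c.IsHomogeneous 𝒜)
    (htb : tt k A ∈ b) (htc : tt k A ∈ c) (hab : a ≤ b) (hac : a ≤ c)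
    (hbc : b * c ≤ (a ⊔ Ideal.span {tt k A}).radical)
    (hbcx : b ⊔ c ≤ x.asIdeal) (hD : wDp (WR k A) m 2 a) {j : ℕ}
    (h0 : NzHigh 𝒜 j (tt k A) a)
    (h1 : ∀ n, Ch x (b ⊔ c) n → Ch x b (n + 1)) (h2 : ∀ n, Ch x (b ⊔ c) n → Ch x c (n + 1))
    (hm : m ≤ (b ⊔ c).radical) : False := by
  have key : ∀ b : Ideal A, tt k A ∈ b → Ch x b 1 → ¬ m ≤ b.radical := by
    intro b htb hb hmb
    obtain ⟨p, hp, hpx⟩ := Ch_lt hb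
    apply hpx.not_ge
    show x.asIdeal ≤ p.asIdeal
    rw [hx]
    refine sup_le (hmb.trans (p.2.isRadical.radical_le_iff.2 hp)) ?_
    rw [Ideal.span_singleton_le_iff_mem]
    exact hp htb
  exact core H ha hb hc htb htc hab hac hbc hm (key b htb (h1 0 (Ch_zero hbcx)))
    (key c htc (h2 0 (Ch_zero hbcx))) hD h0

theorem claimT [IsNoetherianRing A] (H : StdGr 𝒜 m) {x : PrimeSpectrum A}
    (hx : x.asIdeal = m ⊔ Ideal.span {tt k A}) (e : ℕ) : ∀ {a b c : Ideal A}
    (_ : a.IsHomogeneous 𝒜) (_ : b.IsHomogeneous 𝒜) (_ : c.IsHomogeneous 𝒜)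
    (_ : tt k A ∈ b) (_ : tt k A ∈ c) (_ : a ≤ b) (_ : a ≤ c)
    (_ : b * c ≤ (a ⊔ Ideal.span {tt k A}).radical)
    (_ : b ⊔ c ≤ x.asIdeal) (_ : wDp (WR k A) m (e + 2) a)
    (_ : ∃ j, NzHigh 𝒜 j (tt k A) a) (_ : ¬ Ch x (b ⊔ c) (e + 1))
    (_ : ∀ n, Ch x (b ⊔ c) n → Ch x b (n + 1)) (_ : ∀ n, Ch x (b ⊔ c) n → Ch x c (n + 1)),
    False := by
  induction e with
  | zero =>
    intro a b c ha hb hc htb htc hab hac hbc hbcx hD ⟨j, h0⟩ hJ h1 h2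
    by_cases hm : m ≤ (b ⊔ c).radical
    · exact claimT_base H hx ha hb hc htb htc hab hac hbc hbcx hD h0 h1 h2 hm
    · refine hJ (Ch_succ (Ch_zero (le_refl x.asIdeal)) hbcx fun p hp hxp => ?_)
      refine H.min_not_le hx (hb.sup hc) (Ideal.mem_sup_left htb) hm p hp (le_trans ?_ hxp)
      rw [hx]; exact le_sup_left
  | succ e ih =>
    intro a b c ha hb hc htb htc hab hac hbc hbcx hD ⟨j, h0⟩ hJ h1 h2
    by_cases hm : m ≤ (b ⊔ c).radical
    · exact claimT_base H hx ha hb hc htb htc hab hac hbc hbcx (wDp_mono (by omega) hD) h0 h1 h2 hm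
    · obtain ⟨J1, hJ1, hJ1ass, ⟨j1, hj1⟩, -⟩ := sat_exists m (a ⊔ Ideal.span {tt k A})
      have hmin := H.min_not_le hx (hb.sup hc) (Ideal.mem_sup_left htb) hm
      obtain ⟨d, hd, f, hf, hfS⟩ := H.avoid
        (S := associatedPrimes A (A ⧸ wCl (WR k A) a) ∪ (associatedPrimes A (A ⧸ J1) ∪
          (b ⊔ c).minimalPrimes))
        ((associatedPrimes.finite A _).union ((associatedPrimes.finite A _).union
          (Ideal.finite_minimalPrimes_of_isNoetherianRing A _)))
        (by
          rintro p (hp | hp | hp)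
          exacts [hp.isPrime, hp.isPrime, hp.isPrime])
        (by
          obtain ⟨x, hx, hxr, -⟩ := hD
          rintro p (hp | hp | hp)
          exacts [wAss_not_le _ m hx hxr p hp, hJ1ass p hp, hmin p hp])
      have hfreg : wReg (WR k A) a f := wReg_of_notMem _ fun p hp => hfS p (Or.inl hp)
      have hfm : f ∈ m := by simpa using H.mem_pow hf hd
      have hfx : f ∈ x.asIdeal := by rw [hx]; exact Ideal.mem_sup_left hfm
      have hup : ∀ n, Ch x (b ⊔ c ⊔ Ideal.span {f}) n → Ch x (b ⊔ c) (n + 1) := fun n hn =>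
        Ch_succ hn le_sup_left fun p hp h => hfS p (Or.inr (Or.inr hp))
          (h (Ideal.mem_sup_right (Ideal.mem_span_singleton_self f)))
      have F2 : NzHigh 𝒜 (max j j1) f (a ⊔ Ideal.span {tt k A}) := by
        intro d hd z hz h
        refine hj1 z (reg_of_notMem_ass (fun p hp => hfS p (Or.inr (Or.inl hp))) z (hJ1 h)) ?_
        exact H.mem_pow hz (by omega)
      refine ih (a := a ⊔ Ideal.span {f}) (b := b ⊔ Ideal.span {f}) (c := c ⊔ Ideal.span {f})
        (hom_sup_span 𝒜 ha hf) (hom_sup_span 𝒜 hb hf) (hom_sup_span 𝒜 hc hf)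
        (Ideal.mem_sup_left htb) (Ideal.mem_sup_left htc) (sup_le_sup_right hab _)
        (sup_le_sup_right hac _) ?_ ?_ (wDp_exchange _ m _ a f hD hfreg)
        ⟨_, nz_perm ha (tt_mem 𝒜) hf (h0.mono (le_max_left _ _)) F2⟩ ?_ ?_ ?_
      · rw [sup_right_comm, Ideal.sup_mul, Ideal.mul_sup]
        have hl : Ideal.span {f} ≤ (a ⊔ Ideal.span {tt k A} ⊔ Ideal.span {f}).radical :=
          le_sup_right.trans Ideal.le_radical
        refine sup_le (sup_le (hbc.trans (Ideal.radical_mono le_sup_left)) ?_) ?_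
        · exact Ideal.mul_le_right.trans hl
        · exact Ideal.mul_le_left.trans hl
      · rw [sup3]; exact sup_le hbcx (by rwa [Ideal.span_singleton_le_iff_mem])
      · rw [sup3]; exact fun h => hJ (hup _ h)
      · rw [sup3]; exact fun n h => Ch_cut (h1 _ (hup _ h)) hfx
      · rw [sup3]; exact fun n h => Ch_cut (h2 _ (hup _ h)) hfx

theorem claimT'_base [IsNoetherianRing A] (H : StdGr 𝒜 m) {a : Ideal A}
    (ha : a.IsHomogeneous 𝒜) (ham : a ≤ m) (hD : wDp (WR k A) m 1 a)
    (hm : m ≤ (a ⊔ Ideal.span {tt k A}).radical) : False := by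
  obtain ⟨j, hj⟩ := Ideal.exists_pow_le_of_le_radical_of_fg hm (IsNoetherian.noetherian _)
  let π : A →ₗ[A] A ⧸ a := Submodule.mkQ a
  have ht := tt_mem (k := k) 𝒜
  have h1 : Submodule.map π (m ^ j) ≤ Ideal.span {tt k A} • Submodule.map π (m ^ j) := by
    rw [Submodule.map_le_iff_le_comap]
    intro z hz
    classical
    rw [← sum_support_decompose 𝒜 z]
    refine Submodule.sum_mem _ fun i _ => ?_
    by_cases hi : i < j
    · rw [H.h2 j z hz i hi]; simp
    · have hzi := SetLike.coe_mem (decompose 𝒜 z i)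
      obtain ⟨v, hv, hva⟩ := hom_split 𝒜 ha ht hzi (d := i) (by omega)
        (hj (H.mem_pow hzi (by omega)))
      rw [Submodule.mem_comap]
      have : π (decompose 𝒜 z i : A) = tt k A • π v := by
        rw [← map_smul, ← sub_eq_zero, ← map_sub]
        exact (Submodule.Quotient.mk_eq_zero a).2 hva
      rw [this]
      exact Submodule.smul_mem_smul (Ideal.mem_span_singleton_self _)
        (Submodule.mem_map_of_mem (H.mem_pow hv (by omega)))
  obtain ⟨r, hr, hr2⟩ := Submodule.exists_sub_one_mem_and_smul_eq_zero_of_fg_of_le_smul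
    (Ideal.span {tt k A}) _ (IsNoetherian.noetherian _) h1
  obtain ⟨s, hs⟩ := Ideal.mem_span_singleton'.1 hr
  obtain ⟨w, hw⟩ := H.h0 _ (SetLike.coe_mem (decompose 𝒜 s 0))
  have hr0 : (decompose 𝒜 r 0 : A) = algebraMap k[X] A (1 + X * w) := by
    have e : r = 1 + tt k A * s := by rw [mul_comm, hs]; ring
    have e2 := coe_decompose_mul_add_of_left_mem 𝒜 (b := s) (j := 0) ht
    rw [zero_add] at e2
    rw [e, decompose_add, DirectSum.add_apply, Submodule.coe_add, e2, ← hw,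
      decompose_of_mem_same 𝒜 SetLike.GradedOne.one_mem]
    simp
  have hne : (1 + X * w : k[X]) ≠ 0 := by
    intro h
    have := congrArg (Polynomial.eval 0) h
    simp at this
  have hcl : m ^ j ≤ wCl (WR k A) a := by
    intro z hz
    refine ⟨_, mem_WR.2 ⟨_, hne, rfl⟩, ?_⟩
    rw [← hr0]
    classical
    rw [← sum_support_decompose 𝒜 z, Finset.mul_sum]
    refine Ideal.sum_mem _ fun i _ => ?_
    by_cases hi : i < j
    · rw [H.h2 j z hz i hi]; simp
    · have hzi := SetLike.coe_mem (decompose 𝒜 z i)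
      have h3 := hr2 (π (decompose 𝒜 z i : A))
        (Submodule.mem_map_of_mem (H.mem_pow hzi (by omega)))
      rw [← map_smul] at h3
      have h4 : (decompose 𝒜 z i : A) * r ∈ a := by
        rw [mul_comm]; exact (Submodule.Quotient.mk_eq_zero a).1 h3
      have h5 := ha (i + 0) h4
      rw [coe_decompose_mul_add_of_left_mem 𝒜 hzi] at h5
      rwa [mul_comm]
  obtain ⟨x, hx, hxr, -⟩ := hD
  have h1 : (1 : A) ∈ wCl (WR k A) a :=
    wReg_pow hxr j 1 (by rw [mul_one]; exact hcl (Ideal.pow_mem_pow hx j))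
  obtain ⟨ρ, hρ, hρa⟩ := h1
  obtain ⟨μ, hμ, rfl⟩ := mem_WR.1 hρ
  rw [mul_one] at hρa
  have h6 := H.h2 1 _ (by simpa using ham hρa) 0 (by omega)
  rw [decompose_of_mem_same 𝒜 (SetLike.algebraMap_mem_graded 𝒜 μ)] at h6
  exact hμ (H.inj (by rw [h6, map_zero]))

theorem claimT' [IsNoetherianRing A] (H : StdGr 𝒜 m) {x : PrimeSpectrum A}
    (hx : x.asIdeal = m ⊔ Ideal.span {tt k A}) (e : ℕ) : ∀ {a : Ideal A}
    (_ : a.IsHomogeneous 𝒜) (_ : a ≤ m) (_ : wDp (WR k A) m (e + 1) a)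
    (_ : ¬ Ch x (a ⊔ Ideal.span {tt k A}) (e + 1)), False := by
  induction e with
  | zero =>
    intro a ha ham hD hC
    by_cases hm : m ≤ (a ⊔ Ideal.span {tt k A}).radical
    · exact claimT'_base H ha ham hD hm
    · have hle : a ⊔ Ideal.span {tt k A} ≤ x.asIdeal := by rw [hx]; exact sup_le_sup_right ham _
      refine hC (Ch_succ (Ch_zero (le_refl x.asIdeal)) hle fun p hp hxp => ?_)
      refine H.min_not_le hx (hom_sup_span 𝒜 ha (tt_mem 𝒜))
        (Ideal.mem_sup_right (Ideal.mem_span_singleton_self _)) hm p hp (le_trans ?_ hxp)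
      rw [hx]; exact le_sup_left
  | succ e ih =>
    intro a ha ham hD hC
    by_cases hm : m ≤ (a ⊔ Ideal.span {tt k A}).radical
    · exact claimT'_base H ha ham (wDp_mono (by omega) hD) hm
    · have hmin := H.min_not_le hx (hom_sup_span 𝒜 ha (tt_mem 𝒜))
        (Ideal.mem_sup_right (Ideal.mem_span_singleton_self _)) hm
      obtain ⟨d, hd, f, hf, hfS⟩ := H.avoid
        (S := associatedPrimes A (A ⧸ wCl (WR k A) a) ∪ (a ⊔ Ideal.span {tt k A}).minimalPrimes)
        ((associatedPrimes.finite A _).union (Ideal.finite_minimalPrimes_of_isNoetherianRing A _))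
        (by
          rintro p (hp | hp)
          exacts [hp.isPrime, hp.isPrime])
        (by
          obtain ⟨x, hx, hxr, -⟩ := hD
          rintro p (hp | hp)
          exacts [wAss_not_le _ m hx hxr p hp, hmin p hp])
      have hfreg : wReg (WR k A) a f := wReg_of_notMem _ fun p hp => hfS p (Or.inl hp)
      have hfm : f ∈ m := by simpa using H.mem_pow hf hd
      refine ih (a := a ⊔ Ideal.span {f}) (hom_sup_span 𝒜 ha hf)
        (sup_le ham (by rwa [Ideal.span_singleton_le_iff_mem]))
        (wDp_exchange _ m _ a f hD hfreg) fun h => hC ?_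
      rw [sup_right_comm] at h
      exact Ch_succ h le_sup_left fun p hp h => hfS p (Or.inr hp)
          (h (Ideal.mem_sup_right (Ideal.mem_span_singleton_self f)))

end Claims

set_option synthInstance.maxHeartbeats 1000000
set_option maxHeartbeats 1000000
set_option linter.unusedSectionVars false

section Concrete
open Polynomial
attribute [local instance] MvPolynomial.gradedAlgebra

variable (k : Type) [Field k] (n : ℕ)

theorem decompose_hom (z : MvPolynomial (Fin n) k[X]) (i : ℕ) :
    (DirectSum.decompose (MvPolynomial.homogeneousSubmodule (Fin n) k[X]) z i :
      MvPolynomial (Fin n) k[X]) = MvPolynomial.homogeneousComponent i z := 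
  MvPolynomial.decomposition.decompose'_apply z i

theorem stdGr : StdGr (MvPolynomial.homogeneousSubmodule (Fin n) k[X])
    (MvPolynomial.idealOfVars (Fin n) k[X]) where
  h1 d z hz := by
    rw [MvPolynomial.mem_pow_idealOfVars_iff]
    intro x hx
    have := hz (MvPolynomial.mem_support_iff.1 hx)
    rw [← this, Finsupp.degree_eq_weight_one]; rfl
  h2 j z hz i hi := by
    rw [MvPolynomial.mem_pow_idealOfVars_iff'] at hz
    rw [decompose_hom]
    ext x
    rw [MvPolynomial.coeff_homogeneousComponent]
    split_ifs with h
    · rw [hz x (by omega)]; simp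
    · simp
  h0 z hz := by
    rw [MvPolynomial.homogeneousSubmodule_zero] at hz
    obtain ⟨r, hr⟩ := Submodule.mem_one.1 hz
    exact ⟨r, hr⟩
  inj := MvPolynomial.C_injective _ _

/-- specialization at the origin -/
noncomputable def ev0 : MvPolynomial (Fin n) k[X] →+* k :=
  (Polynomial.evalRingHom 0).comp MvPolynomial.constantCoeff

theorem ker_ev0 : RingHom.ker (ev0 k n) =
    MvPolynomial.idealOfVars (Fin n) k[X] ⊔ Ideal.span {tt k (MvPolynomial (Fin n) k[X])} := by
  apply le_antisymm
  · intro z hz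
    have h0 : (MvPolynomial.constantCoeff z).eval 0 = 0 := hz
    have e : z = (z - MvPolynomial.C (MvPolynomial.constantCoeff z)) + MvPolynomial.C (MvPolynomial.constantCoeff z) := by ring
    rw [e]
    refine Submodule.add_mem_sup ?_ ?_
    · rw [← pow_one (MvPolynomial.idealOfVars (Fin n) k[X]), MvPolynomial.mem_pow_idealOfVars_iff']
      intro x hx
      have : x = 0 := (Finsupp.degree_eq_zero_iff x).1 (by simpa using hx)
      subst this
      simp [MvPolynomial.constantCoeff_eq]
    · have : X ∣ MvPolynomial.constantCoeff z := by
        rw [Polynomial.X_dvd_iff, Polynomial.coeff_zero_eq_eval_zero, h0]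
      obtain ⟨w, hw⟩ := this
      rw [hw, map_mul]
      exact Ideal.mul_mem_right _ _ (Ideal.mem_span_singleton_self _)
  · refine sup_le (Ideal.span_le.2 ?_) (Ideal.span_le.2 ?_)
    · rintro _ ⟨i, rfl⟩
      simp [ev0, RingHom.mem_ker]
    · rintro _ rfl
      show ev0 k n (MvPolynomial.C X) = 0
      simp [ev0]

/-- the origin -/
noncomputable def orig : PrimeSpectrum (MvPolynomial (Fin n) k[X]) :=
  ⟨RingHom.ker (ev0 k n), RingHom.ker_isPrime _⟩

theorem orig_asIdeal : (orig k n).asIdeal =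
    MvPolynomial.idealOfVars (Fin n) k[X] ⊔ Ideal.span {tt k (MvPolynomial (Fin n) k[X])} :=
  ker_ev0 k n

end Concrete

set_option synthInstance.maxHeartbeats 1000000
set_option maxHeartbeats 1000000
set_option linter.unusedSectionVars false

section CoeffMap

variable {R R' : Type} [CommRing R] [CommRing R'] {n : ℕ}

/-- transform the coefficients -/
noncomputable def cmap (φ : (Fin n →₀ ℕ) → R → R') (F : MvPolynomial (Fin n) R) :
    MvPolynomial (Fin n) R' :=
  ∑ a ∈ F.support, MvPolynomial.monomial a (φ a (F.coeff a))

theorem coeff_cmap {φ : (Fin n →₀ ℕ) → R → R'} (h : ∀ a, φ a 0 = 0) (F : MvPolynomial (Fin n) R)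
    (a : Fin n →₀ ℕ) : (cmap φ F).coeff a = φ a (F.coeff a) := by
  classical
  unfold cmap
  rw [MvPolynomial.coeff_sum]
  simp only [MvPolynomial.coeff_monomial]
  rw [Finset.sum_ite_eq' F.support a]
  split_ifs with h1
  · rfl
  · rw [MvPolynomial.notMem_support_iff.1 h1, h]

end CoeffMap

section Deform
open Polynomial
attribute [local instance] MvPolynomial.gradedAlgebra

variable {k : Type} [Field k] {n : ℕ}

/-- coefficient of `t^j` -/
noncomputable def tc (j : ℕ) (F : MvPolynomial (Fin n) k[X]) : MvPolynomial (Fin n) k :=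
  cmap (fun _ p => p.coeff j) F

theorem coeff_tc (j : ℕ) (F : MvPolynomial (Fin n) k[X]) (a : Fin n →₀ ℕ) :
    (tc j F).coeff a = (F.coeff a).coeff j := coeff_cmap (by simp) F a

theorem tc_add (j : ℕ) (F G : MvPolynomial (Fin n) k[X]) : tc j (F + G) = tc j F + tc j G := by
  ext a; simp [coeff_tc]

theorem tc_zero (j : ℕ) : tc j (0 : MvPolynomial (Fin n) k[X]) = 0 := by
  ext a; simp [coeff_tc]

theorem tc_mul (j : ℕ) (F G : MvPolynomial (Fin n) k[X]) :
    tc j (F * G) = ∑ p ∈ Finset.HasAntidiagonal.antidiagonal j, tc p.1 F * tc p.2 G := by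
  classical
  ext a
  rw [coeff_tc, MvPolynomial.coeff_mul, Polynomial.finsetSum_coeff, MvPolynomial.coeff_sum]
  simp only [Polynomial.coeff_mul, MvPolynomial.coeff_mul, coeff_tc]
  rw [Finset.sum_comm]

theorem tc_map_mul (j : ℕ) (f : MvPolynomial (Fin n) k) (G : MvPolynomial (Fin n) k[X]) :
    tc j (MvPolynomial.map C f * G) = f * tc j G := by
  classical
  ext a
  rw [coeff_tc, MvPolynomial.coeff_mul, Polynomial.finsetSum_coeff, MvPolynomial.coeff_mul]
  simp only [MvPolynomial.coeff_map, Polynomial.coeff_C_mul, coeff_tc]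

theorem tc_C_mul (j : ℕ) (N : ℕ) (G : MvPolynomial (Fin n) k[X]) :
    tc (j + N) (MvPolynomial.C (X ^ N) * G) = tc j G := by
  ext a
  rw [coeff_tc, coeff_tc, MvPolynomial.coeff_C_mul, Polynomial.coeff_X_pow_mul]

/-- The extension of an ideal of `k[x]` to `k[t][x]`. -/
noncomputable def IA (I : Ideal (MvPolynomial (Fin n) k)) : Ideal (MvPolynomial (Fin n) k[X]) where
  carrier := {F | ∀ j, tc j F ∈ I}
  add_mem' := by
    intro F G hF hG j
    rw [tc_add]; exact I.add_mem (hF j) (hG j)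
  zero_mem' := by intro j; rw [tc_zero]; exact I.zero_mem
  smul_mem' := by
    intro F G hG j
    rw [smul_eq_mul, tc_mul]
    exact I.sum_mem fun p _ => I.mul_mem_left _ (hG _)

theorem mem_IA {I : Ideal (MvPolynomial (Fin n) k)} {F : MvPolynomial (Fin n) k[X]} :
    F ∈ IA I ↔ ∀ j, tc j F ∈ I := Iff.rfl

theorem map_C_mem {I : Ideal (MvPolynomial (Fin n) k)} {f : MvPolynomial (Fin n) k} (h : f ∈ I) :
    MvPolynomial.map C f ∈ IA I := by
  intro j
  have := tc_map_mul j f 1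
  rw [mul_one] at this
  rw [this]; exact I.mul_mem_right _ h

/-- weight of an exponent -/
def wt (ω : Fin n → ℕ) (a : Fin n →₀ ℕ) : ℕ := ∑ i, ω i * a i

/-- the torus action -/
noncomputable def th (ω : Fin n → ℕ) : MvPolynomial (Fin n) k[X] →ₐ[k[X]] MvPolynomial (Fin n) k[X] :=
  MvPolynomial.aeval fun i => MvPolynomial.C (X ^ ω i) * MvPolynomial.X i

theorem coeff_th (ω : Fin n → ℕ) (F : MvPolynomial (Fin n) k[X]) (a : Fin n →₀ ℕ) :
    (th ω F).coeff a = X ^ wt ω a * F.coeff a := by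
  classical
  induction F using MvPolynomial.induction_on' generalizing a with
  | add p q hp hq => rw [map_add, MvPolynomial.coeff_add, hp, hq, MvPolynomial.coeff_add]; ring
  | monomial u r =>
    have : th ω (MvPolynomial.monomial u r) = MvPolynomial.monomial u (X ^ wt ω u * r) := by
      rw [th, MvPolynomial.aeval_monomial, Finsupp.prod_fintype _ _ (by simp),
        MvPolynomial.monomial_eq, Finsupp.prod_fintype _ _ (by simp)]
      simp only [mul_pow, Finset.prod_mul_distrib, MvPolynomial.algebraMap_eq, map_mul, map_pow]
      have : ∏ i, ((MvPolynomial.C X : MvPolynomial (Fin n) k[X]) ^ ω i) ^ u i = MvPolynomial.C X ^ wt ω u := by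
        simp only [← pow_mul, Finset.prod_pow_eq_pow_sum, wt]
      rw [this]; ring
    rw [this, MvPolynomial.coeff_monomial, MvPolynomial.coeff_monomial]
    split_ifs with h
    · rw [h]
    · simp

/-- deformation ideal -/
noncomputable def dfi (ω : Fin n → ℕ) (I : Ideal (MvPolynomial (Fin n) k)) :
    Ideal (MvPolynomial (Fin n) k[X]) := (IA I).comap (th ω)

theorem mem_dfi {ω : Fin n → ℕ} {I : Ideal (MvPolynomial (Fin n) k)} {F} :
    F ∈ dfi ω I ↔ ∀ j, tc j (th ω F) ∈ I := Iff.rfl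

theorem dfi_nz (ω : Fin n → ℕ) (I : Ideal (MvPolynomial (Fin n) k)) (F)
    (h : MvPolynomial.C X * F ∈ dfi ω I) : F ∈ dfi ω I := by
  intro j
  have := h (j + 1)
  have e : (th ω) (MvPolynomial.C X * F) = MvPolynomial.C (X ^ 1) * th ω F := by
    rw [map_mul, pow_one]; congr 1; exact AlgHom.commutes _ _
  rwa [e, tc_C_mul] at this

theorem dfi_hom (ω : Fin n → ℕ) {I : Ideal (MvPolynomial (Fin n) k)} (hI : IsGradedIdeal I) :
    (dfi ω I).IsHomogeneous (MvPolynomial.homogeneousSubmodule (Fin n) k[X]) := by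
  intro i F hF
  rw [decompose_hom, mem_dfi]
  intro j
  have : tc j (th ω (MvPolynomial.homogeneousComponent i F)) =
      MvPolynomial.homogeneousComponent i (tc j (th ω F)) := by
    ext a
    simp only [coeff_tc, coeff_th, MvPolynomial.coeff_homogeneousComponent]
    split_ifs <;> simp
  rw [this]
  exact hI _ (hF j) i

theorem dfi_le (ω : Fin n → ℕ) {I : Ideal (MvPolynomial (Fin n) k)} (hI : IsGradedIdeal I)
    (h1 : I ≠ ⊤) : dfi ω I ≤ MvPolynomial.idealOfVars (Fin n) k[X] := by
  intro F hF
  rw [← pow_one (MvPolynomial.idealOfVars (Fin n) k[X]), MvPolynomial.mem_pow_idealOfVars_iff']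
  intro x hx
  have : x = 0 := (Finsupp.degree_eq_zero_iff x).1 (by simpa using hx)
  subst this
  ext j
  have h2 := hI _ (hF j) 0
  rw [MvPolynomial.homogeneousComponent_zero, coeff_tc, coeff_th] at h2
  simp only [wt, Finsupp.coe_zero, Pi.zero_apply, mul_zero, Finset.sum_const_zero, pow_zero,
    one_mul] at h2
  by_contra h3
  apply h1
  refine Ideal.eq_top_of_isUnit_mem _ h2 ?_
  exact (IsUnit.mk0 _ h3).map MvPolynomial.C

/-- homogenization -/
noncomputable def hz (ω : Fin n → ℕ) (N : ℕ) (F : MvPolynomial (Fin n) k[X]) :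
    MvPolynomial (Fin n) k[X] := cmap (fun a p => X ^ (N - wt ω a) * p) F

theorem coeff_hz (ω : Fin n → ℕ) (N : ℕ) (F : MvPolynomial (Fin n) k[X]) (a : Fin n →₀ ℕ) :
    (hz ω N F).coeff a = X ^ (N - wt ω a) * F.coeff a := coeff_cmap (by simp) F a

theorem th_hz (ω : Fin n → ℕ) (N : ℕ) (F : MvPolynomial (Fin n) k[X])
    (h : ∀ a, F.coeff a ≠ 0 → wt ω a ≤ N) : th ω (hz ω N F) = MvPolynomial.C (X ^ N) * F := by
  ext1 a
  rw [coeff_th, coeff_hz, MvPolynomial.coeff_C_mul, ← mul_assoc, ← pow_add]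
  by_cases h1 : F.coeff a = 0
  · rw [h1]; simp
  · rw [Nat.add_sub_cancel' (h a h1)]

theorem exists_bd (ω : Fin n → ℕ) {R : Type} [CommRing R] (F : MvPolynomial (Fin n) R) :
    ∃ N, ∀ a, F.coeff a ≠ 0 → wt ω a ≤ N :=
  ⟨F.support.sup (wt ω), fun _ ha => Finset.le_sup (MvPolynomial.mem_support_iff.2 ha)⟩

theorem coeff_initialForm (ω : Fin n → ℕ) (f : MvPolynomial (Fin n) k) (a : Fin n →₀ ℕ) :
    (initialForm ω f).coeff a = if wt ω a = wDeg ω f then f.coeff a else 0 := by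
  classical
  unfold initialForm
  rw [MvPolynomial.coeff_sum]
  simp only [MvPolynomial.coeff_monomial]
  rw [Finset.sum_ite_eq' _ a]
  have hiff : a ∈ f.support.filter (fun a => ∑ i, ω i * a i = wDeg ω f) ↔
      f.coeff a ≠ 0 ∧ wt ω a = wDeg ω f := by
    rw [Finset.mem_filter, MvPolynomial.mem_support_iff]; rfl
  by_cases h2 : wt ω a = wDeg ω f
  · rw [if_pos h2]
    by_cases h : f.coeff a = 0
    · rw [h]; simp
    · rw [if_pos (hiff.2 ⟨h, h2⟩)]
  · rw [if_neg h2, if_neg fun h => h2 (hiff.1 h).2]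

/-- component of weight `m` -/
noncomputable def wc (ω : Fin n → ℕ) (m : ℕ) (f : MvPolynomial (Fin n) k) :
    MvPolynomial (Fin n) k := cmap (fun a c => if wt ω a = m then c else 0) f

theorem coeff_wc (ω : Fin n → ℕ) (m : ℕ) (f : MvPolynomial (Fin n) k) (a : Fin n →₀ ℕ) :
    (wc ω m f).coeff a = if wt ω a = m then f.coeff a else 0 := coeff_cmap (by simp) f a

theorem sum_wc (ω : Fin n → ℕ) (f : MvPolynomial (Fin n) k) (N : ℕ)
    (hN : ∀ a, f.coeff a ≠ 0 → wt ω a ≤ N) : ∑ m ∈ Finset.range (N + 1), wc ω m f = f := by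
  ext a
  rw [MvPolynomial.coeff_sum]
  simp only [coeff_wc]
  rw [Finset.sum_ite_eq]
  split_ifs with h
  · rfl
  · by_contra h1
    exact h (Finset.mem_range.2 (Nat.lt_succ_of_le (hN a (Ne.symm h1))))

theorem wc_mem_initial (ω : Fin n → ℕ) {I : Ideal (MvPolynomial (Fin n) k)}
    {g : MvPolynomial (Fin n) k} (hg : g ∈ I) (m : ℕ) (hm : ∀ a, g.coeff a ≠ 0 → wt ω a ≤ m) :
    wc ω m g ∈ initialIdeal ω I := by
  by_cases h0 : wc ω m g = 0
  · rw [h0]; exact Ideal.zero_mem _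
  · obtain ⟨a, ha⟩ := MvPolynomial.ne_zero_iff.1 h0
    rw [coeff_wc] at ha
    split_ifs at ha with hw
    · have hd : wDeg ω g = m := by
        apply le_antisymm
        · exact Finset.sup_le fun b hb => hm b (MvPolynomial.mem_support_iff.1 hb)
        · rw [← hw]
          exact Finset.le_sup (f := wt ω) (MvPolynomial.mem_support_iff.2 ha)
      refine Ideal.subset_span ⟨g, hg, fun h => ha (by simp [h]), ?_⟩
      ext b
      rw [coeff_wc, coeff_initialForm, hd]
    · exact absurd rfl ha

/-- specialization at `t = 0` -/
noncomputable def sp0 : MvPolynomial (Fin n) k[X] →+* MvPolynomial (Fin n) k :=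
  MvPolynomial.map (Polynomial.evalRingHom 0)

theorem coeff_sp0 (F : MvPolynomial (Fin n) k[X]) (a : Fin n →₀ ℕ) :
    (sp0 F).coeff a = (F.coeff a).coeff 0 := by
  rw [sp0, MvPolynomial.coeff_map, Polynomial.coe_evalRingHom, Polynomial.coeff_zero_eq_eval_zero]

theorem sp0_surj : Function.Surjective (sp0 : MvPolynomial (Fin n) k[X] → MvPolynomial (Fin n) k) :=
  MvPolynomial.map_surjective _ fun c => ⟨C c, by simp⟩

theorem ker_sp0 : RingHom.ker (sp0 : MvPolynomial (Fin n) k[X] →+* MvPolynomial (Fin n) k) =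
    Ideal.span {tt k (MvPolynomial (Fin n) k[X])} := by
  apply le_antisymm
  · intro F hF
    rw [Ideal.mem_span_singleton]
    show MvPolynomial.C X ∣ F
    rw [MvPolynomial.C_dvd_iff_dvd_coeff]
    intro a
    rw [Polynomial.X_dvd_iff, ← coeff_sp0, (RingHom.mem_ker.1 hF)]; simp
  · rw [Ideal.span_le]
    rintro _ rfl
    show sp0 (MvPolynomial.C X) = 0
    simp [sp0]

theorem map_sp0_dfi (ω : Fin n → ℕ) (I : Ideal (MvPolynomial (Fin n) k)) :
    (dfi ω I).map sp0 = initialIdeal ω I := by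
  apply le_antisymm
  · rw [Ideal.map_le_iff_le_comap]
    intro F hF
    rw [Ideal.mem_comap]
    obtain ⟨N, hN⟩ := exists_bd ω (sp0 F)
    rw [← sum_wc ω _ N hN]
    refine Ideal.sum_mem _ fun m _ => ?_
    have hc : ∀ a, (tc m (th ω F)).coeff a =
        if wt ω a ≤ m then (F.coeff a).coeff (m - wt ω a) else 0 := by
      intro a
      rw [coeff_tc, coeff_th, Polynomial.coeff_X_pow_mul']
    have : wc ω m (sp0 F) = wc ω m (tc m (th ω F)) := by
      ext a
      rw [coeff_wc, coeff_wc, hc, coeff_sp0]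
      split_ifs with h1
      · rw [h1, Nat.sub_self]
      · omega
      · rfl
    rw [this]
    refine wc_mem_initial ω (hF m) m fun a ha => ?_
    rw [hc] at ha
    by_contra h
    rw [if_neg h] at ha
    exact ha rfl
  · refine Ideal.span_le.2 ?_
    rintro _ ⟨f, hf, -, rfl⟩
    have hN : ∀ a, f.coeff a ≠ 0 → wt ω a ≤ wDeg ω f := fun a ha =>
      Finset.le_sup (f := wt ω) (MvPolynomial.mem_support_iff.2 ha)
    have hN' : ∀ a, (MvPolynomial.map (C : k →+* k[X]) f).coeff a ≠ 0 → wt ω a ≤ wDeg ω f := by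
      intro a ha
      refine hN a fun h => ha ?_
      rw [MvPolynomial.coeff_map, h, map_zero]
    have : initialForm ω f = sp0 (hz ω (wDeg ω f) (MvPolynomial.map C f)) := by
      ext a
      rw [coeff_initialForm, coeff_sp0, coeff_hz, MvPolynomial.coeff_map, Polynomial.coeff_mul_C,
        Polynomial.coeff_X_pow]
      by_cases h : f.coeff a = 0
      · simp [h]
      · have := hN a h
        by_cases h2 : wt ω a = wDeg ω f
        · rw [if_pos h2, if_pos (by omega), one_mul]
        · rw [if_neg h2, if_neg (by omega), zero_mul]
    rw [SetLike.mem_coe, this]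
    apply Ideal.mem_map_of_mem
    show th ω _ ∈ IA I
    rw [th_hz ω _ _ hN']
    exact Ideal.mul_mem_left _ _ (map_C_mem hf)

/-- the map to the special fibre -/
noncomputable def toB (ω : Fin n → ℕ) (I : Ideal (MvPolynomial (Fin n) k)) :
    MvPolynomial (Fin n) k[X] →+* MvPolynomial (Fin n) k ⧸ initialIdeal ω I :=
  (Ideal.Quotient.mk _).comp sp0

theorem toB_surj (ω : Fin n → ℕ) (I : Ideal (MvPolynomial (Fin n) k)) :
    Function.Surjective (toB ω I) :=
  Ideal.Quotient.mk_surjective.comp sp0_surj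

theorem ker_toB (ω : Fin n → ℕ) (I : Ideal (MvPolynomial (Fin n) k)) :
    RingHom.ker (toB ω I) = dfi ω I ⊔ Ideal.span {tt k (MvPolynomial (Fin n) k[X])} := by
  rw [toB, ← RingHom.comap_ker, Ideal.mk_ker, ← map_sp0_dfi,
    Ideal.comap_map_of_surjective _ sp0_surj, ← ker_sp0]
  rfl

end Deform

set_option synthInstance.maxHeartbeats 1000000
set_option maxHeartbeats 1000000
set_option linter.unusedSectionVars false

section Transfer
open Polynomial

variable {k : Type} [Field k] {n : ℕ}

theorem tc_sub (j : ℕ) (F G : MvPolynomial (Fin n) k[X]) : tc j (F - G) = tc j F - tc j G := by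
  ext a; simp [coeff_tc]

theorem tc_sum {ι : Type} (s : Finset ι) (j : ℕ) (F : ι → MvPolynomial (Fin n) k[X]) :
    tc j (∑ i ∈ s, F i) = ∑ i ∈ s, tc j (F i) := by
  ext a; simp [coeff_tc, MvPolynomial.coeff_sum]

theorem tc_single (i j : ℕ) (v : MvPolynomial (Fin n) k) :
    tc j (MvPolynomial.C (X ^ i) * MvPolynomial.map C v) = if j = i then v else 0 := by
  ext a
  rw [coeff_tc, MvPolynomial.coeff_C_mul, MvPolynomial.coeff_map, Polynomial.coeff_mul_C,
    Polynomial.coeff_X_pow]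
  split_ifs <;> simp

theorem tc_bd (F : MvPolynomial (Fin n) k[X]) : ∃ M, ∀ j, M ≤ j → tc j F = 0 := by
  refine ⟨F.support.sup (fun a => (F.coeff a).natDegree + 1), fun j hj => ?_⟩
  ext a
  rw [coeff_tc, MvPolynomial.coeff_zero]
  by_cases h : F.coeff a = 0
  · rw [h]; simp
  · apply Polynomial.coeff_eq_zero_of_natDegree_lt
    exact lt_of_lt_of_le (Nat.lt_succ_self _) ((Finset.le_sup
      (f := fun a => (F.coeff a).natDegree + 1) (MvPolynomial.mem_support_iff.2 h)).trans hj)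

theorem dfi_mono (ω : Fin n → ℕ) {I J : Ideal (MvPolynomial (Fin n) k)} (h : I ≤ J) :
    dfi ω I ≤ dfi ω J := fun _ hF j => h (hF j)

theorem th_C (ω : Fin n → ℕ) (r : k[X]) :
    th (k := k) ω (MvPolynomial.C r) = MvPolynomial.C r := AlgHom.commutes _ _

theorem C_mem_WR {r : k[X]} (h : r ≠ 0) :
    (MvPolynomial.C r : MvPolynomial (Fin n) k[X]) ∈ WR k (MvPolynomial (Fin n) k[X]) :=
  mem_WR.2 ⟨r, h, rfl⟩

theorem wReg_transfer (ω : Fin n → ℕ) {I : Ideal (MvPolynomial (Fin n) k)}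
    {x : MvPolynomial (Fin n) k} (hx : ∀ z, x * z ∈ I → z ∈ I) {N : ℕ}
    {x' : MvPolynomial (Fin n) k[X]}
    (hx' : th ω x' = MvPolynomial.C (X ^ N) * MvPolynomial.map C x) :
    wReg (WR k (MvPolynomial (Fin n) k[X])) (dfi ω I) x' := by
  rintro z ⟨_, hr, h⟩
  obtain ⟨r, hr0, rfl⟩ := mem_WR.1 hr
  refine ⟨MvPolynomial.C (r * X ^ N), C_mem_WR (mul_ne_zero hr0 (pow_ne_zero _ X_ne_zero)), ?_⟩
  intro j
  apply hx
  rw [← tc_map_mul]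
  have h2 : tc j (th ω (MvPolynomial.C r * (x' * z))) ∈ I := h j
  convert h2 using 2
  show _ * th ω (MvPolynomial.C (r * X ^ N) * z) = _
  simp only [map_mul, th_C, hx']
  ring

theorem wCl_transfer (ω : Fin n → ℕ) {I : Ideal (MvPolynomial (Fin n) k)}
    {x : MvPolynomial (Fin n) k} {N : ℕ} {x' : MvPolynomial (Fin n) k[X]}
    (hx' : th ω x' = MvPolynomial.C (X ^ N) * MvPolynomial.map C x) :
    wCl (WR k (MvPolynomial (Fin n) k[X])) (dfi ω (I ⊔ Ideal.span {x})) =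
    wCl (WR k (MvPolynomial (Fin n) k[X])) (dfi ω I ⊔ Ideal.span {x'}) := by
  apply le_antisymm
  · rw [← wCl_wCl _ (dfi ω I ⊔ Ideal.span {x'})]
    apply wCl_mono
    intro F hF
    have hv : ∀ j, ∃ v, tc j (th ω F) - x * v ∈ I := by
      intro j
      obtain ⟨u, hu, w, hw, e⟩ := Submodule.mem_sup.1 (hF j)
      obtain ⟨v, rfl⟩ := Ideal.mem_span_singleton'.1 hw
      refine ⟨v, ?_⟩
      have e2 : u + v * x = tc j (th ω F) := e
      rw [← e2]; convert hu using 1; ring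
    choose v hv using hv
    obtain ⟨M, hM⟩ := tc_bd (th ω F)
    let V : MvPolynomial (Fin n) k[X] :=
      ∑ i ∈ Finset.range M, MvPolynomial.C (X ^ i) * MvPolynomial.map C (v i)
    have hV : th ω F - MvPolynomial.map C x * V ∈ IA I := by
      intro j
      rw [tc_sub, tc_map_mul, tc_sum]
      simp only [tc_single]
      rw [Finset.sum_ite_eq]
      split_ifs with h
      · exact hv j
      · rw [hM j (by simpa using h)]; simp
    obtain ⟨N', hN'⟩ := exists_bd ω V
    refine ⟨MvPolynomial.C (X ^ (N + N')), C_mem_WR (pow_ne_zero _ X_ne_zero), ?_⟩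
    have h3 : MvPolynomial.C (X ^ (N + N')) * F - x' * hz ω N' V ∈ dfi ω I := by
      show th ω _ ∈ IA I
      rw [map_sub, map_mul, map_mul, th_hz ω N' V hN', hx', th_C]
      have : (MvPolynomial.C (X ^ (N + N')) * th ω F - MvPolynomial.C (X ^ N) * MvPolynomial.map C x *
          (MvPolynomial.C (X ^ N') * V) : MvPolynomial (Fin n) k[X]) =
          MvPolynomial.C (X ^ (N + N')) * (th ω F - MvPolynomial.map C x * V) := by
        rw [pow_add, map_mul]; ring
      rw [this]
      exact Ideal.mul_mem_left _ _ hV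
    have := Submodule.add_mem_sup h3 (Ideal.mul_mem_right (hz ω N' V) _ (Ideal.mem_span_singleton_self x'))
    simpa using this
  · apply wCl_mono
    refine sup_le (dfi_mono ω le_sup_left) ?_
    rw [Ideal.span_singleton_le_iff_mem]
    show th ω x' ∈ IA _
    rw [hx']
    exact Ideal.mul_mem_left _ _ (map_C_mem (Ideal.mem_sup_right (Ideal.mem_span_singleton_self x)))

theorem wDp_transfer (ω : Fin n → ℕ) (xs : List (MvPolynomial (Fin n) k)) :
    ∀ (I : Ideal (MvPolynomial (Fin n) k))
    (_ : ∀ x ∈ xs, x ∈ MvPolynomial.idealOfVars (Fin n) k)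
    (_ : ∀ (i : ℕ) (h : i < xs.length) z, xs[i] * z ∈ I ⊔ Ideal.ofList (xs.take i) →
      z ∈ I ⊔ Ideal.ofList (xs.take i)),
    wDp (WR k (MvPolynomial (Fin n) k[X])) (MvPolynomial.idealOfVars (Fin n) k[X]) xs.length
      (dfi ω I) := by
  induction xs with
  | nil => intro I _ _; trivial
  | cons x xs ih =>
    intro I hm hr
    obtain ⟨N, hN⟩ := exists_bd ω (MvPolynomial.map (C : k →+* k[X]) x)
    have hx' := th_hz ω N _ hN
    refine ⟨hz ω N (MvPolynomial.map C x), ?_, wReg_transfer ω ?_ hx', ?_⟩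
    · have h0 := hm x (by simp)
      rw [← pow_one (MvPolynomial.idealOfVars (Fin n) _), MvPolynomial.mem_pow_idealOfVars_iff'] at h0 ⊢
      intro a ha
      rw [coeff_hz, MvPolynomial.coeff_map, h0 a ha]; simp
    · intro z hz
      have := hr 0 (by simp) z
      simpa using this (by simpa using hz)
    · refine wDp_congr _ _ _ (wCl_transfer ω hx') (ih _ (fun y hy => hm y (by simp [hy])) ?_)
      intro i hi z hz
      have := hr (i + 1) (by simpa using hi) z
      rw [List.take_succ_cons, Ideal.ofList_cons, ← sup_assoc] at this
      exact this hz

theorem lift_list {R S : Type} [CommRing R] [CommRing S] (f : R →+* S)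
    (hf : Function.Surjective f) (J : Ideal R)
    (rs : List S) (h : ∀ r ∈ rs, r ∈ J.map f) : ∃ xs : List R, xs.map f = rs ∧ ∀ x ∈ xs, x ∈ J := by
  induction rs with
  | nil => exact ⟨[], rfl, by simp⟩
  | cons r rs ih =>
    obtain ⟨xs, h1, h2⟩ := ih fun r hr => h r (by simp [hr])
    obtain ⟨x, hx, hxr⟩ := (Ideal.mem_map_iff_of_surjective f hf).1 (h r (by simp))
    exact ⟨x :: xs, by simp [h1, hxr], by simpa using ⟨hx, h2⟩⟩

theorem wDp_of_regular (ω : Fin n → ℕ) (I : Ideal (MvPolynomial (Fin n) k))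
    (rs : List (MvPolynomial (Fin n) k ⧸ I))
    (hm : ∀ r ∈ rs, r ∈ (MvPolynomial.idealOfVars (Fin n) k).map (Ideal.Quotient.mk I))
    (hr : RingTheory.Sequence.IsWeaklyRegular (MvPolynomial (Fin n) k ⧸ I) rs) :
    wDp (WR k (MvPolynomial (Fin n) k[X])) (MvPolynomial.idealOfVars (Fin n) k[X]) rs.length
      (dfi ω I) := by
  obtain ⟨xs, rfl, hxs⟩ := lift_list _ Ideal.Quotient.mk_surjective _ rs hm
  rw [List.length_map]
  refine wDp_transfer ω xs I hxs ?_
  rw [← Ideal.Quotient.algebraMap_eq, RingTheory.Sequence.isWeaklyRegular_map_algebraMap_iff] at hr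
  intro i hi z hz
  have h1 := hr.regular_mod_prev i hi
  rw [isSMulRegular_quotient_iff_mem_of_smul_mem] at h1
  have key : ∀ J : Ideal (MvPolynomial (Fin n) k), ∀ w : MvPolynomial (Fin n) k,
      (Submodule.mkQ I w) ∈ J • (⊤ : Submodule (MvPolynomial (Fin n) k) (MvPolynomial (Fin n) k ⧸ I))
      ↔ w ∈ I ⊔ J := by
    intro J w
    have : J • (⊤ : Submodule (MvPolynomial (Fin n) k) (MvPolynomial (Fin n) k ⧸ I)) =
        Submodule.map (Submodule.mkQ I) J := by
      conv_rhs => rw [← Ideal.mul_top J, ← smul_eq_mul, Submodule.map_smul'', Submodule.map_top,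
        Submodule.range_mkQ]
    rw [this, ← Submodule.mem_comap, Submodule.comap_map_mkQ]
  have h2 := h1 (Submodule.mkQ I z)
  rw [← map_smul, key, key] at h2
  exact h2 hz

end Transfer

set_option synthInstance.maxHeartbeats 1000000
set_option maxHeartbeats 1000000
set_option linter.unusedSectionVars false

section TopDim
open TopologicalSpace

theorem topDim_bdd {T : Type} [TopologicalSpace T] {N : ℕ} (h : topologicalKrullDim T ≤ N) :
    BddAbove ({-1} ∪ {d : ℤ | ∃ n : ℕ, d = (n : ℤ) ∧
      ∃ c : Fin (n + 1) → IrreducibleCloseds T, StrictMono c}) := by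
  refine ⟨N, ?_⟩
  rintro d (rfl | ⟨n, rfl, c, hc⟩)
  · omega
  · have h1 : ((n : ℕ) : WithBot ℕ∞) ≤ topologicalKrullDim T :=
      Order.le_krullDim_iff.2 ⟨LTSeries.mk n c hc, rfl⟩
    have h2 := h1.trans h
    have : n ≤ N := by exact_mod_cast h2
    exact_mod_cast this

theorem neg_one_le_topDim (T : Type) [TopologicalSpace T] : -1 ≤ topDim T := by
  unfold topDim
  by_cases h : BddAbove ({-1} ∪ {d : ℤ | ∃ n : ℕ, d = (n : ℤ) ∧
      ∃ c : Fin (n + 1) → IrreducibleCloseds T, StrictMono c})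
  · exact le_csSup h (Or.inl rfl)
  · rw [csSup_of_not_bddAbove h, Int.csSup_empty]; omega

theorem le_topDim {T : Type} [TopologicalSpace T] {N : ℕ} (h : topologicalKrullDim T ≤ N) {n : ℕ}
    (hn : (n : WithBot ℕ∞) ≤ topologicalKrullDim T) : (n : ℤ) ≤ topDim T := by
  obtain ⟨l, rfl⟩ := Order.le_krullDim_iff.1 hn
  exact le_csSup (topDim_bdd h) (Or.inr ⟨_, rfl, l.toFun, l.strictMono⟩)

theorem topDim_mono {T T' : Type} [TopologicalSpace T] [TopologicalSpace T'] {N : ℕ}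
    (h : topologicalKrullDim T' ≤ N) (hT : topologicalKrullDim T ≤ topologicalKrullDim T') :
    topDim T ≤ topDim T' := by
  refine csSup_le ⟨-1, Or.inl rfl⟩ ?_
  rintro d (rfl | ⟨n, rfl, c, hc⟩)
  · exact neg_one_le_topDim T'
  · have h1 : ((n : ℕ) : WithBot ℕ∞) ≤ topologicalKrullDim T :=
      Order.le_krullDim_iff.2 ⟨LTSeries.mk n c hc, rfl⟩
    exact le_topDim h (h1.trans hT)

theorem chain_krullDim {B : Type} [CommRing B] (Z : Set (PrimeSpectrum B)) {n : ℕ}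
    (z : Fin (n + 1) → PrimeSpectrum B) (hz : StrictMono z) (hZ : ∀ i, z i ∈ Z) :
    (n : WithBot ℕ∞) ≤ topologicalKrullDim Z := by
  refine Order.le_krullDim_iff.2 ⟨LTSeries.mk n (fun i => (⟨closure {(⟨z i.rev, hZ _⟩ : Z)},
    isIrreducible_singleton.closure, isClosed_closure⟩ : IrreducibleCloseds Z)) ?_, rfl⟩
  intro i j hij
  have h1 : z j.rev < z i.rev := hz (by simpa using hij)
  have h2 : (⟨z j.rev, hZ _⟩ : Z) ⤳ ⟨z i.rev, hZ _⟩ := by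
    rw [subtype_specializes_iff, ← PrimeSpectrum.le_iff_specializes]; exact h1.le
  refine lt_of_le_not_ge (h2.closure_subset) fun h => ?_
  have h3 : (⟨z j.rev, hZ _⟩ : Z) ∈ closure {(⟨z i.rev, hZ _⟩ : Z)} :=
    h (subset_closure rfl)
  rw [← specializes_iff_mem_closure, subtype_specializes_iff, ← PrimeSpectrum.le_iff_specializes] at h3
  exact absurd h1 (not_lt_of_ge h3)

end TopDim

section Main
open DirectSum Polynomial

variable {k : Type} [Field k] {A : Type} [CommRing A] [Algebra k[X] A]
  {𝒜 : ℕ → Submodule k[X] A} [GradedAlgebra 𝒜] {m : Ideal A}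

theorem sInf_le_prime {S : Set (Ideal A)} (hS : S.Finite) {q : Ideal A} (hq : q.IsPrime)
    (h : sInf S ≤ q) : ∃ p ∈ S, p ≤ q := by
  have e : sInf S = hS.toFinset.inf id := by
    rw [Finset.inf_id_eq_sInf]; simp
  rw [e, hq.inf_le'] at h
  simpa using h

theorem Ch_part [IsNoetherianRing A] (H : StdGr 𝒜 m) {x : PrimeSpectrum A}
    (hx : x.asIdeal = m ⊔ Ideal.span {tt k A}) {a : Ideal A} (ha : a.IsHomogeneous 𝒜)
    (h0 : NzHigh 𝒜 0 (tt k A) a) {d : ℕ} (hD : wDp (WR k A) m (d + 1) a)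
    (S T : Set (Ideal A)) (hS : S.Nonempty) (hT : T.Nonempty)
    (hST : S ∪ T = (a ⊔ Ideal.span {tt k A}).minimalPrimes) (hd : Disjoint S T) :
    Ch x (sInf S ⊔ sInf T) d := by
  have hfin := Ideal.finite_minimalPrimes_of_isNoetherianRing A (a ⊔ Ideal.span {tt k A})
  have hS1 : ∀ p ∈ S, p ∈ (a ⊔ Ideal.span {tt k A}).minimalPrimes := fun p hp => hST ▸ Or.inl hp
  have hT1 : ∀ p ∈ T, p ∈ (a ⊔ Ideal.span {tt k A}).minimalPrimes := fun p hp => hST ▸ Or.inr hp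
  have hSf : S.Finite := hfin.subset hS1
  have hTf : T.Finite := hfin.subset hT1
  have hhom := hom_sup_span 𝒜 ha (tt_mem 𝒜)
  have gen : ∀ U : Set (Ideal A), U.Nonempty →
      (∀ p ∈ U, p ∈ (a ⊔ Ideal.span {tt k A}).minimalPrimes) →
      (sInf U).IsHomogeneous 𝒜 ∧ tt k A ∈ sInf U ∧ a ≤ sInf U ∧ sInf U ≤ x.asIdeal := by
    intro U hU hU1
    refine ⟨Ideal.IsHomogeneous.sInf fun p hp => minPrimes_hom hhom (hU1 p hp), ?_, ?_, ?_⟩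
    · rw [Submodule.mem_sInf]
      exact fun p hp => (hU1 p hp).1.2 (Ideal.mem_sup_right (Ideal.mem_span_singleton_self _))
    · exact le_sInf fun p hp => le_sup_left.trans (hU1 p hp).1.2
    · obtain ⟨p, hp⟩ := hU
      exact (sInf_le hp).trans (H.hom_prime_le hx (hU1 p hp).isPrime.ne_top
        (minPrimes_hom hhom (hU1 p hp))
        ((hU1 p hp).1.2 (Ideal.mem_sup_right (Ideal.mem_span_singleton_self _))))
  have gen2 : ∀ U V : Set (Ideal A), U.Finite → V.Finite →
      (∀ p ∈ U, p ∈ (a ⊔ Ideal.span {tt k A}).minimalPrimes) →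
      (∀ p ∈ V, p ∈ (a ⊔ Ideal.span {tt k A}).minimalPrimes) → Disjoint U V →
      ∀ p ∈ (sInf U).minimalPrimes, ¬ sInf V ≤ p := by
    intro U V hUf hVf hU hV hUV p hp hle
    obtain ⟨u, hu, hup⟩ := sInf_le_prime hUf hp.isPrime hp.1.2
    have hpu := hp.2 ⟨(hU u hu).isPrime, sInf_le hu⟩ hup
    obtain ⟨v, hv, hvp⟩ := sInf_le_prime hVf hp.isPrime hle
    have h1 : v ≤ u := hvp.trans hpu
    have h2 := (hU u hu).2 ⟨(hV v hv).isPrime, (hV v hv).1.2⟩ h1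
    have : u = v := le_antisymm h2 h1
    exact Set.disjoint_left.1 hUV hu (this ▸ hv)
  obtain ⟨bh, bt, ba, bx⟩ := gen S hS hS1
  obtain ⟨ch, ct, ca, cx⟩ := gen T hT hT1
  cases d with
  | zero => exact Ch_zero (sup_le bx cx)
  | succ e =>
    by_contra hC
    refine claimT H hx e ha bh ch bt ct ba ca ?_ (sup_le bx cx) hD ⟨0, h0⟩ hC ?_ ?_
    · rw [← Ideal.sInf_minimalPrimes, ← hST, sInf_union]
      exact Ideal.mul_le_inf
    · exact fun n h => Ch_succ h le_sup_left fun p hp hle =>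
        gen2 S T hSf hTf hS1 hT1 hd p hp (le_sup_right.trans hle)
    · exact fun n h => Ch_succ h le_sup_right fun p hp hle =>
        gen2 T S hTf hSf hT1 hS1 hd.symm p hp (le_sup_left.trans hle)

theorem Ch_to_dim {B : Type} [CommRing B] (Φ : A →+* B) (hΦ : Function.Surjective Φ)
    (Z : Set (PrimeSpectrum B)) {x : PrimeSpectrum A} {J : Ideal A} {d : ℕ} (h : Ch x J d)
    (hJ : RingHom.ker Φ ≤ J)
    (hZ : ∀ q : PrimeSpectrum B, J ≤ q.asIdeal.comap Φ → q ∈ Z) :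
    (d : WithBot ℕ∞) ≤ topologicalKrullDim Z := by
  obtain ⟨p, rfl, hp, -⟩ := h
  have h1 : ∀ i, J ≤ (p i).asIdeal := fun i => hp.trans (p.head_le i)
  have h2 : ∀ i, ∃ q : PrimeSpectrum B, PrimeSpectrum.comap Φ q = p i := by
    intro i
    have : p i ∈ Set.range (PrimeSpectrum.comap Φ) := by
      rw [range_comap_of_surjective _ _ hΦ]
      exact hJ.trans (h1 i)
    exact this
  choose z hz using h2
  refine chain_krullDim Z z ?_ fun i => hZ _ ?_
  · intro i j hij
    have := p.strictMono hij
    rw [← hz, ← hz] at this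
    refine lt_of_le_not_ge ?_ ?_
    · intro b hb
      obtain ⟨y, rfl⟩ := hΦ b
      exact this.le hb
    · intro h
      exact absurd this (not_lt_of_ge fun y hy => h hy)
  · have : (PrimeSpectrum.comap Φ (z i)).asIdeal = (p i).asIdeal := by rw [hz]
    rw [← PrimeSpectrum.comap_asIdeal, this]; exact h1 i

theorem main_conn [IsNoetherianRing A] (H : StdGr 𝒜 m) {x : PrimeSpectrum A}
    (hx : x.asIdeal = m ⊔ Ideal.span {tt k A}) {a : Ideal A} (ha : a.IsHomogeneous 𝒜)
    (ham : a ≤ m)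
    (h0 : NzHigh 𝒜 0 (tt k A) a) {d : ℕ} (hD : wDp (WR k A) m (d + 1) a)
    {B : Type} [CommRing B] (Φ : A →+* B) (hΦ : Function.Surjective Φ)
    (hker : RingHom.ker Φ = a ⊔ Ideal.span {tt k A}) (Z : Set (PrimeSpectrum B))
    (hZ : IsClosed Z) (hconn : ¬ ConnectedSpace ↥(Zᶜ)) :
    (d : WithBot ℕ∞) ≤ topologicalKrullDim Z := by
  set K := a ⊔ Ideal.span {tt k A} with hK
  have hZup : ∀ p q : PrimeSpectrum B, p ≤ q → p ∈ Z → q ∈ Z := fun p q h hp =>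
    ((PrimeSpectrum.le_iff_specializes p q).1 h).mem_closed hZ hp
  -- points of minimal primes
  have hpt : ∀ p ∈ K.minimalPrimes, ∃ q : PrimeSpectrum B, q.asIdeal.comap Φ = p := by
    intro p hp
    have : (⟨p, hp.isPrime⟩ : PrimeSpectrum A) ∈ Set.range (PrimeSpectrum.comap Φ) := by
      rw [range_comap_of_surjective _ _ hΦ]
      exact hker.le.trans hp.1.2
    obtain ⟨q, hq⟩ := this
    exact ⟨q, congrArg PrimeSpectrum.asIdeal hq⟩
  have hle : ∀ p q : PrimeSpectrum B, p.asIdeal.comap Φ ≤ q.asIdeal.comap Φ → p ≤ q := by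
    intro p q h b hb
    obtain ⟨y, rfl⟩ := hΦ b
    exact h hb
  have hKq : ∀ q : PrimeSpectrum B, K ≤ q.asIdeal.comap Φ := by
    intro q
    rw [← hker]
    intro y hy
    rw [Ideal.mem_comap, RingHom.mem_ker.1 hy]; exact Ideal.zero_mem _
  have hfin := Ideal.finite_minimalPrimes_of_isNoetherianRing A K
  by_cases hc : ∃ p : PrimeSpectrum B, p ∈ Z ∧ p.asIdeal.comap Φ ∈ K.minimalPrimes
  · obtain ⟨p, hpZ, hp⟩ := hc
    by_cases hT : (K.minimalPrimes \ {p.asIdeal.comap Φ}).Nonempty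
    · have hC := Ch_part H hx ha h0 hD {p.asIdeal.comap Φ} (K.minimalPrimes \ {p.asIdeal.comap Φ})
        (Set.singleton_nonempty _) hT (by
          rw [Set.union_diff_self]; exact Set.union_eq_right.2 (Set.singleton_subset_iff.2 hp)) Set.disjoint_sdiff_right
      refine Ch_to_dim Φ hΦ Z hC ?_ ?_
      · rw [hker]
        exact le_trans (le_sInf (by rintro _ rfl; exact hp.1.2)) le_sup_left
      · intro q hq
        refine hZup p q (hle _ _ ?_) hpZ
        refine le_trans ?_ (le_sup_left.trans hq)
        simp
    · have hC : Ch x K (d + 1) := by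
        by_contra h
        exact claimT' H hx d ha ham hD h
      have h1 : ((d + 1 : ℕ) : WithBot ℕ∞) ≤ topologicalKrullDim Z := by
        refine Ch_to_dim Φ hΦ Z hC hker.le fun q hq => ?_
        obtain ⟨p', hp', hp'q⟩ := Ideal.exists_minimalPrimes_le (hKq q)
        have : p' = p.asIdeal.comap Φ := by
          by_contra hne
          exact hT ⟨p', hp', hne⟩
        exact hZup p q (hle _ _ (this ▸ hp'q)) hpZ
      refine le_trans ?_ h1
      exact_mod_cast Nat.le_succ d
  · push Not at hc
    -- the complement is nonempty, so it is disconnected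
    have hne : (Zᶜ).Nonempty := by
      obtain ⟨p, hp, -⟩ := Ideal.exists_minimalPrimes_le (I := K) (J := x.asIdeal)
        (by rw [hx]; exact sup_le_sup_right ham _)
      obtain ⟨q, hq⟩ := hpt p hp
      exact ⟨q, fun h => hc q h (hq ▸ hp)⟩
    have hpc : ¬ IsPreconnected Zᶜ := by
      intro h
      exact hconn (isConnected_iff_connectedSpace.1 ⟨hne, h⟩)
    unfold IsPreconnected at hpc
    push Not at hpc
    obtain ⟨U, V, hU, hV, hUV, hUn, hVn, hemp⟩ := hpc
    have hgen : ∀ W : Set (PrimeSpectrum B), IsOpen W → ∀ p q : PrimeSpectrum B, p ≤ q → q ∈ W →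
        p ∈ W := fun W hW p q h hq => ((PrimeSpectrum.le_iff_specializes p q).1 h).mem_open hW hq
    let SS : Set (PrimeSpectrum B) → Set (Ideal A) := fun W =>
      {p | p ∈ K.minimalPrimes ∧ ∃ q ∈ W, q.asIdeal.comap Φ = p}
    have hSn : ∀ W : Set (PrimeSpectrum B), IsOpen W → (Zᶜ ∩ W).Nonempty → (SS W).Nonempty := by
      rintro W hW ⟨q, -, hq⟩
      obtain ⟨p, hp, hpq⟩ := Ideal.exists_minimalPrimes_le (hKq q)
      obtain ⟨q', hq'⟩ := hpt p hp
      exact ⟨p, hp, q', hgen W hW q' q (hle _ _ (hq' ▸ hpq)) hq, hq'⟩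
    have hinj : ∀ p q : PrimeSpectrum B, p.asIdeal.comap Φ = q.asIdeal.comap Φ → p = q :=
      fun p q h => le_antisymm (hle _ _ h.le) (hle _ _ h.ge)
    have hC := Ch_part H hx ha h0 hD (SS U) (SS V) (hSn U hU hUn) (hSn V hV hVn) (by
        apply Set.Subset.antisymm
        · rintro p (hp | hp) <;> exact hp.1
        · intro p hp
          obtain ⟨q, hq⟩ := hpt p hp
          rcases hUV (show q ∈ Zᶜ from fun h => hc q h (hq ▸ hp)) with h | h
          · exact Or.inl ⟨hp, q, h, hq⟩
          · exact Or.inr ⟨hp, q, h, hq⟩) (by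
        rw [Set.disjoint_left]
        rintro p ⟨hp, q, hq, hqp⟩ ⟨-, q', hq', hqp'⟩
        have : q = q' := hinj _ _ (hqp.trans hqp'.symm)
        subst this
        have hh : q ∈ Zᶜ ∩ (U ∩ V) := ⟨fun h => hc q h (hqp ▸ hp), hq, hq'⟩
        rw [hemp] at hh
        exact hh)
    refine Ch_to_dim Φ hΦ Z hC ?_ ?_
    · rw [hker]
      exact le_trans (le_sInf fun p hp => hp.1.1.2) le_sup_left
    · intro q hq
      obtain ⟨p1, ⟨hp1, q1, hq1, rfl⟩, h1⟩ := sInf_le_prime (hfin.subset fun p hp => hp.1)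
        (Ideal.IsPrime.comap Φ) (le_sup_left.trans hq)
      obtain ⟨p2, ⟨hp2, q2, hq2, rfl⟩, h2⟩ := sInf_le_prime (hfin.subset fun p hp => hp.1)
        (Ideal.IsPrime.comap Φ) (le_sup_right.trans hq)
      by_contra hqZ
      have key : ∃ r, r ∈ Zᶜ ∩ (U ∩ V) := by
        rcases hUV hqZ with h | h
        · exact ⟨q2, fun h => hc q2 h hp2, hgen U hU q2 q (hle _ _ h2) h, hq2⟩
        · exact ⟨q1, fun h => hc q1 h hp1, hq1, hgen V hV q1 q (hle _ _ h1) h⟩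
      obtain ⟨r, hr⟩ := key
      rw [hemp] at hr
      exact hr

end Main

set_option synthInstance.maxHeartbeats 1000000
set_option maxHeartbeats 1000000
set_option linter.unusedSectionVars false

section DimTrdeg

theorem dim_trdeg (k B : Type) [Field k] [CommRing B] [IsDomain B] [Algebra k B]
    [Algebra.FiniteType k B] : ∃ s : ℕ, ringKrullDim B = s ∧ Algebra.trdeg k B = s := by
  obtain ⟨s, g, hg, hi⟩ := exists_integral_inj_algHom_of_fg k B
  refine ⟨s, ?_, ?_⟩
  · let _ : Algebra (MvPolynomial (Fin s) k) B := g.toRingHom.toAlgebra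
    have : Algebra.IsIntegral (MvPolynomial (Fin s) k) B := ⟨hi⟩
    have hdim : ringKrullDim (MvPolynomial (Fin s) k) = s := by
      rw [MvPolynomial.ringKrullDim_of_isNoetherianRing, ringKrullDim_eq_zero_of_field]
      simp
    apply le_antisymm
    · rw [← hdim]
      exact Order.krullDim_le_of_strictMono
        (PrimeSpectrum.comap (algebraMap (MvPolynomial (Fin s) k) B))
        (fun p q h => Ideal.IsIntegral.comap_lt_comap (R := MvPolynomial (Fin s) k) h)
    · obtain ⟨l, hl⟩ := Order.le_krullDim_iff.1 (show ((s : ℕ) : WithBot ℕ∞) ≤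
        Order.krullDim (PrimeSpectrum (MvPolynomial (Fin s) k)) from hdim.ge)
      obtain ⟨Q, hQ, hQl⟩ := Ideal.exists_ideal_over_prime_of_isIntegral_of_isDomain (S := B)
        (RelSeries.head l).asIdeal (by
          have : RingHom.ker (algebraMap (MvPolynomial (Fin s) k) B) = ⊥ :=
            (RingHom.injective_iff_ker_eq_bot _).1 hg
          rw [this]; exact bot_le)
      have : Q.LiesOver (RelSeries.head l).asIdeal := ⟨hQl.symm⟩
      obtain ⟨L, hL, -⟩ := Ideal.exists_ltSeries_of_hasGoingUp (S := B) l Q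
      exact Order.le_krullDim_iff.2 ⟨L, hL.trans hl⟩
  · let _ : Algebra (MvPolynomial (Fin s) k) B := g.toRingHom.toAlgebra
    have : Algebra.IsIntegral (MvPolynomial (Fin s) k) B := ⟨hi⟩
    have : IsScalarTower k (MvPolynomial (Fin s) k) B :=
      IsScalarTower.of_algebraMap_eq fun r => (g.commutes r).symm
    have : FaithfulSMul (MvPolynomial (Fin s) k) B :=
      (faithfulSMul_iff_algebraMap_injective _ _).2 hg
    have h1 := (IsTranscendenceBasis.mvPolynomial (Fin s) k).algebraMap_comp (A := B)
    have := h1.lift_cardinalMk_eq_trdeg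
    simpa using this.symm

theorem trdeg_le_dim {k R ι : Type} [Field k] [CommRing R] [Algebra k R]
    [Algebra.FiniteType k R] [Finite ι] (x : ι → R) (hx : AlgebraicIndependent k x) :
    ((Nat.card ι : ℕ) : WithBot ℕ∞) ≤ ringKrullDim R := by
  let S : Submonoid R := (nonZeroDivisors (MvPolynomial ι k)).map (MvPolynomial.aeval (R := k) x)
  obtain ⟨q, hq, -, hqS⟩ := Ideal.exists_le_prime_disjoint (⊥ : Ideal R) S (by
    rw [Set.disjoint_left]
    rintro _ h ⟨f, hf, rfl⟩
    exact nonZeroDivisors.ne_zero hf (algebraicIndependent_iff.1 hx f h))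
  have hx' : AlgebraicIndependent k (fun i => Ideal.Quotient.mkₐ k q (x i)) := by
    rw [algebraicIndependent_iff]
    intro f hf
    by_contra h0
    have h1 : MvPolynomial.aeval (R := k) (fun i => Ideal.Quotient.mkₐ k q (x i)) f =
        Ideal.Quotient.mkₐ k q (MvPolynomial.aeval x f) := by
      rw [MvPolynomial.comp_aeval_apply]
    rw [h1, Ideal.Quotient.mkₐ_eq_mk, Ideal.Quotient.eq_zero_iff_mem] at hf
    exact Set.disjoint_left.1 hqS hf ⟨f, mem_nonZeroDivisors_of_ne_zero h0, rfl⟩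
  obtain ⟨s, hs, ht⟩ := dim_trdeg k (R ⧸ q)
  have h2 := hx'.cardinalMk_le_trdeg
  rw [ht] at h2
  refine le_trans ?_ (hs.symm.le.trans (ringKrullDim_quotient_le q))
  have : Nat.card ι ≤ s := by
    have := Cardinal.toNat_le_toNat h2 (Cardinal.natCast_lt_aleph0)
    rw [Cardinal.toNat_natCast] at this
    exact this
  exact_mod_cast this

theorem exists_indep_vars {k R : Type} [Field k] [CommRing R] [Algebra k R] {n : ℕ}
    (Φ : MvPolynomial (Fin n) k →ₐ[k] R) (hΦ : Function.Surjective Φ) (e : ℕ)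
    (he : (e : WithBot ℕ∞) ≤ ringKrullDim R) :
    ∃ T : Set (Fin n), e ≤ Nat.card T ∧
      AlgebraicIndependent k (fun i : T => Φ (MvPolynomial.X i.1)) := by
  have : Algebra.FiniteType k R := Algebra.FiniteType.of_surjective Φ hΦ
  obtain ⟨l, hl⟩ := Order.le_krullDim_iff.1 he
  set p := RelSeries.head l with hp
  have h1 : (e : WithBot ℕ∞) ≤ ringKrullDim (R ⧸ p.asIdeal) := by
    have h2 : (PrimeSpectrum.zeroLocus (p.asIdeal : Set R)) = Set.Ici p := by
      ext q; rfl
    rw [ringKrullDim_quotient, h2, ← Order.coheight_eq_krullDim_Ici]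
    have := Order.length_le_coheight_head (p := l)
    rw [hl] at this
    exact_mod_cast this
  obtain ⟨s, hs, ht⟩ := dim_trdeg k (R ⧸ p.asIdeal)
  rw [hs] at h1
  let Ψ : MvPolynomial (Fin n) k →ₐ[k] (R ⧸ p.asIdeal) := (Ideal.Quotient.mkₐ k p.asIdeal).comp Φ
  have hΨ : Function.Surjective Ψ := (Ideal.Quotient.mkₐ_surjective k _).comp hΦ
  have hadj : Algebra.adjoin k (Set.range fun i => Ψ (MvPolynomial.X i)) = ⊤ := by
    rw [Algebra.adjoin_range_eq_range_aeval]
    change (MvPolynomial.aeval (⇑Ψ ∘ MvPolynomial.X)).range = ⊤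
    rw [← MvPolynomial.aeval_unique Ψ]
    exact (AlgHom.range_eq_top _).2 hΨ
  have : Algebra.IsAlgebraic (Algebra.adjoin k (Set.range fun i => Ψ (MvPolynomial.X i)))
      (R ⧸ p.asIdeal) := by
    refine ⟨fun b => ?_⟩
    have : b = algebraMap (Algebra.adjoin k (Set.range fun i => Ψ (MvPolynomial.X i))) _
      ⟨b, hadj ▸ Algebra.mem_top⟩ := rfl
    rw [this]
    exact isAlgebraic_algebraMap _
  obtain ⟨t, htS, htb⟩ := exists_isTranscendenceBasis_subset (R := k)
    (Set.range fun i => Ψ (MvPolynomial.X i))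
  choose f hf using fun y : t => htS y.2
  have hfi : Function.Injective f := fun a b h => by
    apply Subtype.ext
    rw [← hf a, ← hf b, h]
  have hcard : Nat.card t = s := by
    have := htb.cardinalMk_eq_trdeg
    rw [ht] at this
    rw [Nat.card, this]; simp
  refine ⟨Set.range f, ?_, ?_⟩
  · rw [Nat.card_congr (Equiv.ofInjective f hfi).symm, hcard]
    exact_mod_cast h1
  · have h3 : AlgebraicIndependent k (fun i : Set.range f => Ψ (MvPolynomial.X i.1)) := by
      rw [← algebraicIndependent_equiv (Equiv.ofInjective f hfi)]
      convert htb.1 using 1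
      funext y
      exact hf y
    exact AlgebraicIndependent.of_comp (Ideal.Quotient.mkₐ k p.asIdeal) h3

theorem dim_initial {k : Type} [Field k] {n : ℕ} (ω : Fin n → ℕ)
    (I : Ideal (MvPolynomial (Fin n) k)) :
    ringKrullDim (MvPolynomial (Fin n) k ⧸ initialIdeal ω I) ≤
      ringKrullDim (MvPolynomial (Fin n) k ⧸ I) := by
  refine iSup_le fun l => ?_
  obtain ⟨T, hT, hTi⟩ := exists_indep_vars (Ideal.Quotient.mkₐ k (initialIdeal ω I))
    (Ideal.Quotient.mkₐ_surjective k _) l.length (Order.le_krullDim_iff.2 ⟨l, rfl⟩)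
  have key : ∀ (J : Ideal (MvPolynomial (Fin n) k)) (q : MvPolynomial T k),
      MvPolynomial.aeval (R := k) (fun i : T => Ideal.Quotient.mkₐ k J (MvPolynomial.X i.1)) q = 0 ↔
      MvPolynomial.rename Subtype.val q ∈ J := by
    intro J q
    rw [← Ideal.Quotient.eq_zero_iff_mem, ← Ideal.Quotient.mkₐ_eq_mk k,
      MvPolynomial.rename_eq_aeval, MvPolynomial.comp_aeval_apply]
    rfl
  have h2 : AlgebraicIndependent k (fun i : T => Ideal.Quotient.mkₐ k I (MvPolynomial.X i.1)) := by
    rw [algebraicIndependent_iff]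
    intro q hq
    rw [key] at hq
    by_contra h0
    set f := MvPolynomial.rename (R := k) (Subtype.val : T → Fin n) q with hf
    have hf0 : f ≠ 0 := by
      intro h
      exact h0 (MvPolynomial.rename_injective _ Subtype.val_injective (by rw [map_zero]; exact h))
    have hin : initialForm ω f ∈ initialIdeal ω I := Ideal.subset_span ⟨f, hq, hf0, rfl⟩
    have hsupp : (initialForm ω f).support ⊆ f.support := by
      intro a ha
      rw [MvPolynomial.mem_support_iff, coeff_initialForm] at ha
      rw [MvPolynomial.mem_support_iff]
      intro h
      rw [h] at ha
      simp at ha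
    have hvars : ((initialForm ω f).vars : Set (Fin n)) ⊆ Set.range (Subtype.val : T → Fin n) := by
      intro i hi
      obtain ⟨a, ha, hia⟩ := (MvPolynomial.mem_vars i).1 hi
      have h3 : i ∈ f.vars := (MvPolynomial.mem_vars i).2 ⟨a, hsupp ha, hia⟩
      classical
      have h4 := MvPolynomial.vars_rename (Subtype.val : T → Fin n) q h3
      obtain ⟨j, -, hj⟩ := Finset.mem_image.1 h4
      exact ⟨j, hj⟩
    obtain ⟨q', hq'⟩ := MvPolynomial.exists_rename_eq_of_vars_subset_range _ _
      Subtype.val_injective hvars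
    rw [← hq', ← key] at hin
    have hz := algebraicIndependent_iff.1 hTi q' hin
    rw [hz, map_zero] at hq'
    obtain ⟨a, ha, hae⟩ := Finset.exists_mem_eq_sup f.support
      (MvPolynomial.support_nonempty.2 hf0) (fun a => ∑ i, ω i * a i)
    have h5 := coeff_initialForm ω f a
    rw [← hq', if_pos (show wt ω a = wDeg ω f from hae.symm)] at h5
    exact (MvPolynomial.mem_support_iff.1 ha) (by rw [← h5]; simp)
  refine le_trans ?_ (trdeg_le_dim _ h2)
  exact_mod_cast hT

end DimTrdeg

set_option synthInstance.maxHeartbeats 1000000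
set_option maxHeartbeats 1000000
set_option linter.unusedSectionVars false

section Final
open Polynomial
attribute [local instance] MvPolynomial.gradedAlgebra

theorem dim_quot_le {k : Type} [Field k] {n : ℕ} (J : Ideal (MvPolynomial (Fin n) k)) :
    topologicalKrullDim (PrimeSpectrum (MvPolynomial (Fin n) k ⧸ J)) ≤ (n : ℕ) := by
  rw [PrimeSpectrum.topologicalKrullDim_eq_ringKrullDim]
  refine (ringKrullDim_quotient_le J).trans ?_
  rw [MvPolynomial.ringKrullDim_of_isNoetherianRing, ringKrullDim_eq_zero_of_field]
  simp

theorem le_connDim {T : Type} [TopologicalSpace T] (c : ℤ)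
    (h : ∀ Z : Set T, IsClosed Z → ¬ ConnectedSpace ↥(Zᶜ) → c ≤ topDim ↥Z) : c ≤ connDim T := by
  refine le_csInf ⟨_, Set.univ, isClosed_univ, ?_, rfl⟩ ?_
  · intro hc
    obtain ⟨x, hx⟩ := hc.toNonempty
    exact hx trivial
  · rintro d ⟨Z, hZ, hc, rfl⟩
    exact h Z hZ hc

theorem neg_one_le_connDim (T : Type) [TopologicalSpace T] : -1 ≤ connDim T :=
  le_connDim _ fun Z _ _ => neg_one_le_topDim Z

theorem part1 {k : Type} [Field k] {n : ℕ} (I : Ideal (MvPolynomial (Fin n) k))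
    (hI : IsGradedIdeal I) (ω : Fin n → ℕ) (rs : List (MvPolynomial (Fin n) k ⧸ I))
    (hm : ∀ r ∈ rs, r ∈ (MvPolynomial.idealOfVars (Fin n) k).map (Ideal.Quotient.mk I))
    (hr : RingTheory.Sequence.IsRegular (MvPolynomial (Fin n) k ⧸ I) rs) :
    (rs.length : ℤ) - 1 ≤
      connDim (PrimeSpectrum (MvPolynomial (Fin n) k ⧸ initialIdeal ω I)) := by
  rcases Nat.eq_zero_or_pos rs.length with h0 | h0
  · rw [h0]
    exact neg_one_le_connDim _
  obtain ⟨d, hd⟩ := Nat.exists_eq_succ_of_ne_zero h0.ne'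
  have h1 : I ≠ ⊤ := by
    rintro rfl
    have hs : Subsingleton (MvPolynomial (Fin n) k ⧸ (⊤ : Ideal (MvPolynomial (Fin n) k))) :=
      Ideal.Quotient.subsingleton_iff.2 rfl
    exact hr.top_ne_smul (Subsingleton.elim _ _)
  have hW := wDp_of_regular ω I rs hm hr.toIsWeaklyRegular
  rw [hd] at hW
  refine le_connDim _ fun Z hZ hc => ?_
  have h2 := main_conn (stdGr k n) (orig_asIdeal k n) (dfi_hom ω hI) (dfi_le ω hI h1)
    (fun _ _ z _ hz => dfi_nz ω I z hz) hW (toB ω I) (toB_surj ω I) (ker_toB ω I) Z hZ hc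
  have h3 := le_topDim (N := n)
    ((Topology.IsInducing.subtypeVal.topologicalKrullDim_le).trans (dim_quot_le _)) h2
  rw [hd]
  push_cast
  linarith

theorem part1' {k : Type} [Field k] {n : ℕ} (I : Ideal (MvPolynomial (Fin n) k))
    (hI : IsGradedIdeal I) (ω : Fin n → ℕ) :
    connDim (PrimeSpectrum (MvPolynomial (Fin n) k ⧸ initialIdeal ω I)) ≥
        idealDepth (MvPolynomial (Fin n) k ⧸ I)
          ((Ideal.span (Set.range (MvPolynomial.X : Fin n → MvPolynomial (Fin n) k))).map
            (Ideal.Quotient.mk I)) (MvPolynomial (Fin n) k ⧸ I) - 1 := by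
  unfold idealDepth
  set S := {d : ℤ | ∃ rs : List (MvPolynomial (Fin n) k ⧸ I), d = (rs.length : ℤ) ∧
    (∀ r ∈ rs, r ∈ ((Ideal.span (Set.range (MvPolynomial.X : Fin n → MvPolynomial (Fin n) k))).map
            (Ideal.Quotient.mk I))) ∧
    RingTheory.Sequence.IsRegular (MvPolynomial (Fin n) k ⧸ I) rs} with hS
  have hneg := neg_one_le_connDim (PrimeSpectrum (MvPolynomial (Fin n) k ⧸ initialIdeal ω I))
  by_cases hb : BddAbove S
  · rcases S.eq_empty_or_nonempty with he | hne
    · rw [he, Int.csSup_empty]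
      linarith
    · obtain ⟨rs, h1, h2, h3⟩ := Int.csSup_mem hne hb
      rw [h1]
      exact part1 I hI ω rs h2 h3
  · rw [csSup_of_not_bddAbove hb, Int.csSup_empty]
    linarith

end Final

/-- Let `k` be a field, `P = k[x₁, …, xₙ]`, `ω ∈ (ℤ_{>0})ⁿ` a weight
vector and `I ⊆ P` a graded ideal.  Then `c(P/in_ω(I)) ≥ depth(P/I) − 1`, the depth being
taken with respect to the maximal homogeneous ideal (the image of `(x₁, …, xₙ)`).
In particular, if `P/I` is Cohen–Macaulay (depth = dimension), then `P/in_ω(I)` is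
connected in codimension 1. -/
theorem stmt_1 {k : Type} [Field k] {n : ℕ} (I : Ideal (MvPolynomial (Fin n) k))
    (hI : IsGradedIdeal I) (ω : Fin n → ℕ) (hω : ∀ i, 0 < ω i) :
    connDim (PrimeSpectrum (MvPolynomial (Fin n) k ⧸ initialIdeal ω I)) ≥
        idealDepth (MvPolynomial (Fin n) k ⧸ I)
          ((Ideal.span (Set.range (MvPolynomial.X : Fin n → MvPolynomial (Fin n) k))).map
            (Ideal.Quotient.mk I)) (MvPolynomial (Fin n) k ⧸ I) - 1 ∧
      (idealDepth (MvPolynomial (Fin n) k ⧸ I)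
          ((Ideal.span (Set.range (MvPolynomial.X : Fin n → MvPolynomial (Fin n) k))).map
            (Ideal.Quotient.mk I)) (MvPolynomial (Fin n) k ⧸ I) =
          topDim (PrimeSpectrum (MvPolynomial (Fin n) k ⧸ I)) →
        connDim (PrimeSpectrum (MvPolynomial (Fin n) k ⧸ initialIdeal ω I)) ≥
          topDim (PrimeSpectrum (MvPolynomial (Fin n) k ⧸ initialIdeal ω I)) - 1) := by
  refine ⟨part1' I hI ω, fun hCM => ?_⟩
  have h1 := part1' I hI ω
  rw [hCM] at h1
  have h2 : topDim (PrimeSpectrum (MvPolynomial (Fin n) k ⧸ initialIdeal ω I)) ≤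
      topDim (PrimeSpectrum (MvPolynomial (Fin n) k ⧸ I)) := by
    refine topDim_mono (dim_quot_le I) ?_
    rw [PrimeSpectrum.topologicalKrullDim_eq_ringKrullDim,
      PrimeSpectrum.topologicalKrullDim_eq_ringKrullDim]
    exact dim_initial ω I
  linarith
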